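/- Let Ω ⊂ ℝⁿ be a bounded open set, 1 < p < 2, T > 0, and let V : Ω → ℝ be continuous. Suppose u : Ω × (0, T) → ℝ is positive, continuously differentiable in t, twice continuously differentiable in x, the vector field x ↦ ‖∇u(x,t)‖^{p−2} ∇u(x,t) is continuously differentiable in x for each t (interpreted as 0 where ∇u = 0), and u satisfies pointwise on Ω × (0, T): ∂u/∂t = div(‖∇u‖^{p−2} ∇u) + V u^{p−1}. Then for every φ ∈ C_c^∞(Ω) and all 0 < t₁ < t₂ < T: ∫_Ω V |φ|^p dx − ∫_Ω ‖∇φ‖^p dx ≤ (1/((2−p)(t₂ − t₁))) ∫_Ω ( u(x, t₂)^{2−p} − u(x, t₁)^{2−p} ) |φ(x)|^p dx. -/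

import Mathlib

open MeasureTheory Set

/-- The vector field `‖∇u‖^{p−2} ∇u` (equal to the zero vector wherever
`∇u = 0`, by the `Real.rpow` convention `0^{p-2} = 0` for `p ≠ 2`). -/
noncomputable def pVF {n : ℕ} (p : ℝ) (u : EuclideanSpace ℝ (Fin n) → ℝ)
    (x : EuclideanSpace ℝ (Fin n)) : EuclideanSpace ℝ (Fin n) :=
  ‖gradient u x‖ ^ (p - 2) • gradient u x

/-- The p-Laplacian `Δ_p u = div(‖∇u‖^{p−2} ∇u)`. -/
noncomputable def pLaplacian {n : ℕ} (p : ℝ) (u : EuclideanSpace ℝ (Fin n) → ℝ)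
    (x : EuclideanSpace ℝ (Fin n)) : ℝ :=
  ∑ i : Fin n, fderiv ℝ (pVF p u) x (EuclideanSpace.single i 1) i

open Filter Topology

/-- The bounded components of an open subset of a bounded interval. -/
theorem exists_countable_components {O : Set ℝ} (hO : IsOpen O) {s s' : ℝ} (hOs : O ⊆ Ioo s s') :
    ∃ S : Set (ℝ × ℝ), S.Countable ∧
      (∀ q ∈ S, q.1 < q.2 ∧ Ioo q.1 q.2 ⊆ O ∧ q.1 ∉ O ∧ q.2 ∉ O) ∧
      S.PairwiseDisjoint (fun q => Ioo q.1 q.2) ∧ ⋃ q : S, Ioo q.1.1 q.1.2 = O := by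
  set S : Set (ℝ × ℝ) := {q | q.1 < q.2 ∧ Ioo q.1 q.2 ⊆ O ∧ q.1 ∉ O ∧ q.2 ∉ O} with hS
  have hdisj : S.PairwiseDisjoint (fun q => Ioo q.1 q.2) := by
    intro q hq q' hq' hne
    by_contra hnd
    obtain ⟨t, ht, ht'⟩ := not_disjoint_iff.1 hnd
    refine hne (Prod.ext ?_ ?_)
    · by_contra h
      rcases lt_or_gt_of_ne h with h | h
      · exact hq'.2.2.1 (hq.2.1 ⟨h, ht'.1.trans ht.2⟩)
      · exact hq.2.2.1 (hq'.2.1 ⟨h, ht.1.trans ht'.2⟩)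
    · by_contra h
      rcases lt_or_gt_of_ne h with h | h
      · exact hq.2.2.2 (hq'.2.1 ⟨ht'.1.trans ht.2, h⟩)
      · exact hq'.2.2.2 (hq.2.1 ⟨ht.1.trans ht'.2, h⟩)
  refine ⟨S, hdisj.countable_of_isOpen (fun _ _ => isOpen_Ioo) (fun q hq => nonempty_Ioo.2 hq.1),
    fun q hq => hq, hdisj, ?_⟩
  apply Subset.antisymm
  · exact iUnion_subset fun q => q.2.2.1
  · intro t ht
    have hts := hOs ht
    obtain ⟨a, ha, hamax⟩ : ∃ a, IsGreatest (Oᶜ ∩ Icc s t) a :=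
      (isCompact_Icc.inter_left hO.isClosed_compl).exists_isGreatest
        ⟨s, fun h => lt_irrefl _ (hOs h).1, le_rfl, hts.1.le⟩
    obtain ⟨b, hb, hbmin⟩ : ∃ b, IsLeast (Oᶜ ∩ Icc t s') b :=
      (isCompact_Icc.inter_left hO.isClosed_compl).exists_isLeast
        ⟨s', fun h => lt_irrefl _ (hOs h).2, hts.2.le, le_rfl⟩
    have hat : a < t := lt_of_le_of_ne ha.2.2 (fun h => ha.1 (h ▸ ht))
    have htb : t < b := lt_of_le_of_ne hb.2.1 (fun h => hb.1 (h ▸ ht))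
    refine mem_iUnion.2 ⟨⟨(a, b), hat.trans htb, ?_, ha.1, hb.1⟩, hat, htb⟩
    intro r hr
    by_contra hrO
    rcases le_total r t with h | h
    · exact absurd (hamax ⟨hrO, ha.2.1.trans hr.1.le, h⟩) (not_le.2 hr.1)
    · exact absurd (hbmin ⟨hrO, h, hr.2.le.trans hb.2.2⟩) (not_le.2 hr.2)

/-- Fatou's lemma for a pointwise convergent series whose negative parts are summable in `L¹`. -/
theorem tsum_le_integral_of_hasSum {X : Type*} [MeasurableSpace X] {μ : Measure X} {κ : Type*}
    [Countable κ] {R : κ → X → ℝ} {S : X → ℝ} {r b : κ → ℝ} (hR : ∀ k, Integrable (R k) μ)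
    (hS : Integrable S μ) (hsum : ∀ x, HasSum (fun k => R k x) (S x))
    (hr : ∀ k, r k ≤ ∫ x, R k x ∂μ) (hb : ∀ k, ∫ x, max (-R k x) 0 ∂μ ≤ b k)
    (hrs : Summable r) (hbs : Summable b) : ∑' k, r k ≤ ∫ x, S x ∂μ := by
  set N : κ → X → ℝ := fun k x => max (-R k x) 0 with hN
  have hN0 : ∀ k x, 0 ≤ N k x := fun k x => le_max_right _ _
  have hNi : ∀ k, Integrable (N k) μ := fun k => (hR k).neg.pos_part
  have hNs : Summable fun k => ∫ x, N k x ∂μ :=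
    Summable.of_nonneg_of_le (fun k => integral_nonneg (hN0 k)) hb hbs
  have hNs' : Summable fun k => ∫ x, ‖N k x‖ ∂μ := by
    simpa only [Real.norm_of_nonneg (hN0 _ _)] using hNs
  have hNx : ∀ x, Summable fun k => N k x := fun x =>
    Summable.of_nonneg_of_le (fun k => hN0 k x)
      (fun k => max_le (neg_le_abs _) (abs_nonneg _)) (hsum x).summable.abs
  have hNint := hasSum_integral_of_summable_integral_norm hNi hNs'
  have hh : Integrable (fun x => ∑' k, N k x) μ := by
    refine ⟨aestronglyMeasurable_of_tendsto_ae (u := (atTop : Filter (Finset κ)))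
      (f := fun F x => ∑ k ∈ F, N k x) (fun F => ?_) (ae_of_all _ fun x => (hNx x).hasSum), ?_⟩
    · exact (integrable_finsetSum F fun k _ => hNi k).aestronglyMeasurable
    · rw [hasFiniteIntegral_iff_ofReal (ae_of_all _ fun x => tsum_nonneg fun k => hN0 k x)]
      simp_rw [ENNReal.ofReal_tsum_of_nonneg (fun k => hN0 k _) (hNx _)]
      rw [lintegral_tsum fun k => (hNi k).aemeasurable.ennreal_ofReal]
      simp_rw [← ofReal_integral_eq_lintegral_ofReal (hNi _) (ae_of_all _ (hN0 _))]
      rw [← ENNReal.ofReal_tsum_of_nonneg (fun k => integral_nonneg (hN0 k)) hNs]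
      exact ENNReal.ofReal_lt_top
  have hRN : ∀ k, Integrable (fun x => R k x + N k x) μ := fun k => (hR k).add (hNi k)
  have key : ∀ F : Finset κ, ∑ k ∈ F, r k + ∑ k ∈ F, ∫ x, N k x ∂μ
      ≤ ∫ x, S x ∂μ + ∫ x, ∑' k, N k x ∂μ := by
    intro F
    have h1 : ∑ k ∈ F, ∫ x, (R k x + N k x) ∂μ ≤ ∫ x, (S x + ∑' k, N k x) ∂μ := by
      rw [← integral_finsetSum F fun k _ => hRN k]
      refine integral_mono (integrable_finsetSum F fun k _ => hRN k) (hS.add hh) ?_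
      intro x
      refine sum_le_hasSum F (fun k _ => ?_) ((hsum x).add (hNx x).hasSum)
      have := le_max_left (-R k x) 0
      simp only [hN]; linarith
    rw [integral_add hS hh] at h1
    simp_rw [integral_add (hR _) (hNi _)] at h1
    rw [Finset.sum_add_distrib] at h1
    linarith [Finset.sum_le_sum fun k (_ : k ∈ F) => hr k]
  simp_rw [← Finset.sum_add_distrib] at key
  have := le_of_tendsto (hrs.hasSum.add hNint) (Eventually.of_forall key)
  linarith

/-- A bounded functional `W`, differentiable in time, whose time derivative has integral at least
`c` at every time and whose variation is controlled by that of `m`. -/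
structure IsLowerFlow {X : Type*} [MeasurableSpace X] (μ : Measure X) (α β : ℝ)
    (m m' W W' : ℝ → X → ℝ) (c : ℝ → ℝ) : Prop where
  hasDeriv : ∀ t ∈ Icc α β, ∀ x, HasDerivAt (fun s => W s x) (W' t x) t
  cont : ∀ x, ContinuousOn (fun t => W' t x) (Icc α β)
  meas : ∀ t ∈ Icc α β, AEStronglyMeasurable (W t) μ
  meas' : ∀ t ∈ Icc α β, StronglyMeasurable (W' t)
  bdd : ∃ M, ∀ t ∈ Icc α β, ∀ x, |W t x| ≤ M
  deriv_le : ∀ t ∈ Icc α β, ∀ x, |W' t x| ≤ |m' t x|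
  sub_le : ∀ s ∈ Icc α β, ∀ t ∈ Icc α β, ∀ x, W s x - W t x ≤ max (m s x - m t x) 0
  rate : IntegrableOn c (Icc α β)
  rate_le : ∀ t ∈ Icc α β, c t ≤ ∫ x, W' t x ∂μ

section LowerFlow

variable {X : Type*} [MeasurableSpace X] {μ : Measure X} {α β : ℝ} {m m' : ℝ → X → ℝ}

/-- Every lower flow gains at least the integral of its rate between the times `s` and `t`. -/
def FlowMono (μ : Measure X) (α β : ℝ) (m m' : ℝ → X → ℝ) (s t : ℝ) : Prop :=
  ∀ W W' c, IsLowerFlow μ α β m m' W W' c → ∫ r in s..t, c r ≤ ∫ x, W t x ∂μ - ∫ x, W s x ∂μ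

/-- At times where `m'` is bounded by `N`, there are lower flows anchored at that time. -/
def HasAnchors (μ : Measure X) (α β : ℝ) (m m' : ℝ → X → ℝ) (N C : ℝ) : Prop :=
  ∀ a ∈ Icc α β, (∀ x, |m' a x| ≤ N) → ∀ δ > 0, ∃ W W' c, IsLowerFlow μ α β m m' W W' c ∧
    (∀ t ∈ Icc α β, -C ≤ c t) ∧ (∀ t ∈ Icc α β, ∀ x, max (m a x - m t x) 0 ≤ -W t x) ∧
    ∫ x, -W a x ∂μ ≤ δ

theorem IsLowerFlow.integrable [IsFiniteMeasure μ] {W W' : ℝ → X → ℝ} {c : ℝ → ℝ}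
    (h : IsLowerFlow μ α β m m' W W' c) {t : ℝ} (ht : t ∈ Icc α β) : Integrable (W t) μ := by
  obtain ⟨M, hM⟩ := h.bdd
  exact Integrable.of_bound (h.meas t ht) M (ae_of_all _ (hM t ht))

theorem IsLowerFlow.intervalIntegrable {W W' : ℝ → X → ℝ} {c : ℝ → ℝ}
    (h : IsLowerFlow μ α β m m' W W' c) {s t : ℝ} (hs : s ∈ Icc α β) (ht : t ∈ Icc α β) :
    IntervalIntegrable c volume s t :=
  (h.rate.mono_set (uIcc_subset_Icc hs ht)).intervalIntegrable

theorem FlowMono.trans {r s t : ℝ} (h : FlowMono μ α β m m' r s) (h' : FlowMono μ α β m m' s t)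
    (hr : r ∈ Icc α β) (hs : s ∈ Icc α β) (ht : t ∈ Icc α β) : FlowMono μ α β m m' r t := by
  intro W W' c hW
  rw [← intervalIntegral.integral_add_adjacent_intervals (hW.intervalIntegrable hr hs)
    (hW.intervalIntegrable hs ht)]
  linarith [h W W' c hW, h' W W' c hW]

theorem FlowMono.refl (s : ℝ) : FlowMono μ α β m m' s s := fun W W' c _ => by simp

theorem IsLowerFlow.continuousOn_integral [IsFiniteMeasure μ] {W W' : ℝ → X → ℝ} {c : ℝ → ℝ}
    (h : IsLowerFlow μ α β m m' W W' c) : ContinuousOn (fun t => ∫ x, W t x ∂μ) (Icc α β) := by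
  obtain ⟨M, hM⟩ := h.bdd
  refine continuousOn_of_dominated (bound := fun _ => M) h.meas
    (fun t ht => ae_of_all _ (hM t ht)) (integrable_const _) (ae_of_all _ fun x t ht => ?_)
  exact (h.hasDeriv t ht x).continuousAt.continuousWithinAt

theorem FlowMono.of_Ioo [IsFiniteMeasure μ] {a b : ℝ} (ha : a ∈ Icc α β) (hb : b ∈ Icc α β)
    (hab : a < b) (h : ∀ s t, a < s → s ≤ t → t < b → FlowMono μ α β m m' s t) :
    FlowMono μ α β m m' a b := by
  intro W W' c hW
  have hsub : Icc a b ⊆ Icc α β := Icc_subset_Icc ha.1 hb.2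
  have hD : ContinuousOn (fun t => ∫ x, W t x ∂μ - ∫ r in a..t, c r) (Icc a b) := by
    refine (hW.continuousOn_integral.mono hsub).sub ?_
    have := intervalIntegral.continuousOn_primitive_interval (μ := volume) (f := c) (a := a) (b := b)
      (by rw [uIcc_of_le hab.le]; exact hW.rate.mono_set hsub)
    rwa [uIcc_of_le hab.le] at this
  have hmono : MonotoneOn (fun t => ∫ x, W t x ∂μ - ∫ r in a..t, c r) (Ioo a b) := by
    intro s hs t ht hst
    have hs' := hsub (Ioo_subset_Icc_self hs)
    have ht' := hsub (Ioo_subset_Icc_self ht)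
    have := h s t hs.1 hst ht.2 W W' c hW
    have h2 := intervalIntegral.integral_add_adjacent_intervals (hW.intervalIntegrable ha hs')
      (hW.intervalIntegrable hs' ht')
    simp only
    linarith
  have hmid : (a + b) / 2 ∈ Ioo a b := ⟨by linarith, by linarith⟩
  have h1 := ContinuousWithinAt.closure_le (s := Ioo a ((a + b) / 2)) (x := a)
    (by rw [closure_Ioo hmid.1.ne]; exact left_mem_Icc.2 hmid.1.le)
    ((hD a (left_mem_Icc.2 hab.le)).mono
      (Ioo_subset_Icc_self.trans (Icc_subset_Icc_right hmid.2.le))) continuousWithinAt_const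
    fun t ht => hmono ⟨ht.1, ht.2.trans hmid.2⟩ hmid ht.2.le
  have h2 := ContinuousWithinAt.closure_le (s := Ioo ((a + b) / 2) b) (x := b)
    (by rw [closure_Ioo hmid.2.ne]; exact right_mem_Icc.2 hmid.2.le) continuousWithinAt_const
    ((hD b (right_mem_Icc.2 hab.le)).mono
      (Ioo_subset_Icc_self.trans (Icc_subset_Icc_left hmid.1.le)))
    fun t ht => hmono hmid ⟨hmid.1.trans ht.1, ht.2⟩ ht.1.le
  have := h1.trans h2
  simp only [intervalIntegral.integral_same] at this
  linarith

theorem FlowMono.of_locally {a b : ℝ} (ha : a ∈ Icc α β) (hb : b ∈ Icc α β)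
    (hab : a ≤ b)
    (h : ∀ t ∈ Icc a b, ∃ r > 0, ∀ s ∈ Icc α β, ∀ s' ∈ Icc α β, s ≤ s' → t - r < s → s' < t + r →
      FlowMono μ α β m m' s s') :
    FlowMono μ α β m m' a b := by
  choose! r hr hr' using h
  obtain ⟨u, hu0, hum, ⟨k, hk⟩, hui⟩ := exists_monotone_Icc_subset_open_cover_Icc hab
    (c := fun t : Icc a b => {s : Icc a b | (s : ℝ) ∈ Ioo (t - r t) (t + r t)})
    (fun t => isOpen_Ioo.preimage continuous_subtype_val)
    (fun t _ => mem_iUnion.2 ⟨t, by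
      have := hr t t.2
      constructor <;> linarith⟩)
  have hsub : Icc a b ⊆ Icc α β := Icc_subset_Icc ha.1 hb.2
  have : ∀ n, FlowMono μ α β m m' a (u n) := by
    intro n
    induction n with
    | zero => rw [hu0]; exact .refl a
    | succ n ih =>
      obtain ⟨i, hi⟩ := hui n
      have hle := hum (Nat.le_succ n)
      refine ih.trans (hr' i i.2 _ (hsub (u n).2) _ (hsub (u (n+1)).2) hle
        (hi (left_mem_Icc.2 hle)).1 (hi (right_mem_Icc.2 hle)).2) ha (hsub (u n).2) (hsub (u _).2)
  have h2 := this k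
  rwa [hk k le_rfl] at h2

theorem HasAnchors.integral_max_le [IsFiniteMeasure μ] {N C a b : ℝ}
    (hA : HasAnchors μ α β m m' N C) (ha : a ∈ Icc α β) (hb : b ∈ Icc α β) (hab : a ≤ b)
    (haN : ∀ x, |m' a x| ≤ N) (hab' : FlowMono μ α β m m' a b) {W W' : ℝ → X → ℝ} {c : ℝ → ℝ}
    (hW : IsLowerFlow μ α β m m' W W' c) :
    ∫ x, max (-(W b x - W a x)) 0 ∂μ ≤ C * (b - a) := by
  refine le_of_forall_pos_le_add fun δ hδ => ?_
  obtain ⟨Y, Y', d, hY, hd, hle, hδ'⟩ := hA a ha haN δ hδ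
  have h1 := hab' Y Y' d hY
  have h2 : ∫ r in a..b, -C ≤ ∫ r in a..b, d r :=
    intervalIntegral.integral_mono_on hab intervalIntegrable_const (hY.intervalIntegrable ha hb)
      fun t ht => hd t ⟨ha.1.trans ht.1, ht.2.trans hb.2⟩
  rw [intervalIntegral.integral_const, smul_eq_mul] at h2
  have h3 : ∫ x, max (-(W b x - W a x)) 0 ∂μ ≤ ∫ x, -Y b x ∂μ := by
    refine integral_mono (((hW.integrable hb).sub (hW.integrable ha)).neg.pos_part)
      (hY.integrable hb).neg fun x => ?_
    refine le_trans (max_le ?_ (le_max_right _ _)) (hle b hb x)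
    rw [neg_sub]
    exact hW.sub_le a ha b hb x
  rw [integral_neg] at h3 hδ'
  linarith

theorem FlowMono.of_bounded_on_closed [IsFiniteMeasure μ] {N C s s' : ℝ} {Z : Set ℝ}
    (hA : HasAnchors μ α β m m' N C) (hs : s ∈ Icc α β) (hs' : s' ∈ Icc α β) (hss' : s ≤ s')
    (hZ : IsClosed Z) (hZN : ∀ t ∈ Z ∩ Icc s s', ∀ x, |m' t x| ≤ N) (hsN : ∀ x, |m' s x| ≤ N)
    (hgap : ∀ a b, s ≤ a → a < b → b ≤ s' → Disjoint (Ioo a b) Z → FlowMono μ α β m m' a b) :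
    FlowMono μ α β m m' s s' := by
  intro W W' c hW
  have hsub : Icc s s' ⊆ Icc α β := Icc_subset_Icc hs.1 hs'.2
  obtain ⟨S, hSc, hS, hSd, hSU⟩ := exists_countable_components (O := Ioo s s' \ Z)
    (isOpen_Ioo.sdiff hZ) sdiff_subset
  have := hSc.to_subtype
  have hq : ∀ q : S, s ≤ q.1.1 ∧ q.1.1 < q.1.2 ∧ q.1.2 ≤ s' ∧ Disjoint (Ioo q.1.1 q.1.2) Z ∧
      ∀ x, |m' q.1.1 x| ≤ N := by
    intro q
    obtain ⟨h1, h2, h3, -⟩ := hS q q.2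
    obtain ⟨h4, h5⟩ := (Ioo_subset_Ioo_iff h1).1 (h2.trans sdiff_subset)
    refine ⟨h4, h1, h5, disjoint_left.2 fun t ht => (h2 ht).2, ?_⟩
    rcases h4.eq_or_lt with h | h
    · rwa [← h]
    · refine hZN _ ⟨?_, h4, h1.le.trans h5⟩
      by_contra hnZ
      exact h3 ⟨⟨h, h1.trans_le h5⟩, hnZ⟩
  have hq1 : ∀ q : S, q.1.1 ∈ Icc α β := fun q =>
    hsub ⟨(hq q).1, (hq q).2.1.le.trans (hq q).2.2.1⟩
  have hq2 : ∀ q : S, q.1.2 ∈ Icc α β := fun q =>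
    hsub ⟨(hq q).1.trans (hq q).2.1.le, (hq q).2.2.1⟩
  have hflow : ∀ q : S, FlowMono μ α β m m' q.1.1 q.1.2 := fun q =>
    hgap _ _ (hq q).1 (hq q).2.1 (hq q).2.2.1 (hq q).2.2.2.1
  have hpd : Pairwise (Function.onFun Disjoint fun q : S => Ioo q.1.1 q.1.2) := fun q q' hne =>
    hSd q.2 q'.2 (fun h => hne (Subtype.ext h))
  set E := Ioo s s' ∩ Z with hE
  have hEm : MeasurableSet E := measurableSet_Ioo.inter hZ.measurableSet
  have hW'i : ∀ x, IntegrableOn (fun t => W' t x) (Icc s s') := fun x =>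
    ((hW.cont x).mono hsub).integrableOn_Icc
  have hftc : ∀ x a b, a ∈ Icc s s' → b ∈ Icc s s' → a ≤ b →
      ∫ t in Ioo a b, W' t x = W b x - W a x := by
    intro x a b ha hb hab
    rw [← integral_Ioc_eq_integral_Ioo, ← intervalIntegral.integral_of_le hab]
    refine intervalIntegral.integral_eq_sub_of_hasDerivAt (fun t ht => hW.hasDeriv t ?_ x) ?_
    · exact hsub (uIcc_subset_Icc ha hb ht)
    · exact ((hW'i x).mono_set (uIcc_subset_Icc ha hb)).intervalIntegrable
  have hOsub : Ioo s s' \ Z ⊆ Icc s s' := sdiff_subset.trans Ioo_subset_Icc_self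
  have hsum : ∀ x, HasSum (fun q : S => W q.1.2 x - W q.1.1 x)
      (W s' x - W s x - ∫ t in E, W' t x) := by
    intro x
    have h1 := hasSum_integral_iUnion (μ := volume) (f := fun t => W' t x)
      (fun q : S => measurableSet_Ioo (a := q.1.1) (b := q.1.2)) hpd
      (by rw [hSU]; exact (hW'i x).mono_set hOsub)
    rw [hSU] at h1
    have h2 := integral_inter_add_sdiff (μ := volume) (f := fun t => W' t x) (s := Ioo s s')
      hZ.measurableSet ((hW'i x).mono_set Ioo_subset_Icc_self)
    rw [hftc x s s' (left_mem_Icc.2 hss') (right_mem_Icc.2 hss') hss'] at h2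
    rw [show W s' x - W s x - ∫ t in E, W' t x = ∫ t in Ioo s s' \ Z, W' t x by linarith]
    have h3 : ∀ q : S, ∫ t in Ioo q.1.1 q.1.2, W' t x = W q.1.2 x - W q.1.1 x := fun q =>
      hftc x _ _ ⟨(hq q).1, (hq q).2.1.le.trans (hq q).2.2.1⟩
        ⟨(hq q).1.trans (hq q).2.1.le, (hq q).2.2.1⟩ (hq q).2.1.le
    simpa only [h3] using h1
  have hci : IntegrableOn c (Icc s s') := hW.rate.mono_set hsub
  have hsumc : HasSum (fun q : S => ∫ r in q.1.1..q.1.2, c r) (∫ r in Ioo s s' \ Z, c r) := by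
    have h1 := hasSum_integral_iUnion (μ := volume) (f := c)
      (fun q : S => measurableSet_Ioo (a := q.1.1) (b := q.1.2)) hpd
      (by rw [hSU]; exact hci.mono_set hOsub)
    rw [hSU] at h1
    have h3 : ∀ q : S, ∫ r in Ioo q.1.1 q.1.2, c r = ∫ r in q.1.1..q.1.2, c r := fun q => by
      rw [intervalIntegral.integral_of_le (hq q).2.1.le, integral_Ioc_eq_integral_Ioo]
    simpa only [h3] using h1
  have hsuml : Summable fun q : S => C * (q.1.2 - q.1.1) := by
    have h1 := hasSum_integral_iUnion (μ := volume) (f := fun _ : ℝ => (1 : ℝ))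
      (fun q : S => measurableSet_Ioo (a := q.1.1) (b := q.1.2)) hpd
      (by rw [hSU]; exact (continuousOn_const.integrableOn_Icc).mono_set hOsub)
    refine (h1.summable.congr fun q => ?_).mul_left C
    simp [(hq q).2.1.le]
  have hprod : Integrable (Function.uncurry fun t x => W' (projIcc s s' hss' t) x)
      ((volume.restrict E).prod μ) := by
    have : IsFiniteMeasure ((volume : Measure ℝ).restrict E) :=
      ⟨by rw [Measure.restrict_apply_univ]
          exact (measure_mono (inter_subset_left.trans Ioo_subset_Icc_self)).trans_lt
            measure_Icc_lt_top⟩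
    refine Integrable.of_bound (C := N) (StronglyMeasurable.aestronglyMeasurable
      (stronglyMeasurable_uncurry_of_continuous_of_stronglyMeasurable (fun x => ?_)
      fun t => hW.meas' _ (hsub (projIcc s s' hss' t).2))) ?_
    · exact ((hW.cont x).mono hsub).comp_continuous
        (continuous_subtype_val.comp continuous_projIcc) fun t => (projIcc s s' hss' t).2
    · rw [← Measure.restrict_univ (μ := μ), Measure.prod_restrict]
      filter_upwards [ae_restrict_mem (hEm.prod .univ)] with p hp
      have hpI : p.1 ∈ Icc s s' := Ioo_subset_Icc_self hp.1.1
      simp only [Function.uncurry, projIcc_of_mem hss' hpI]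
      exact (hW.deriv_le _ (hsub hpI) _).trans (hZN _ ⟨hp.1.2, hpI⟩ _)
  have hproj : ∀ x, ∫ t in E, W' (projIcc s s' hss' t) x = ∫ t in E, W' t x := fun x =>
    setIntegral_congr_fun hEm fun t ht => by
      simp only [projIcc_of_mem hss' (Ioo_subset_Icc_self ht.1)]
  have hTi : Integrable (fun x => ∫ t in E, W' t x) μ := by
    simpa only [Function.uncurry, hproj] using hprod.integral_prod_right
  have hT : ∫ r in E, c r ≤ ∫ x, (∫ t in E, W' t x) ∂μ := by
    simp_rw [← hproj]
    have hswap := integral_integral_swap hprod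
    rw [← hswap]
    refine setIntegral_mono_on (hci.mono_set (inter_subset_left.trans Ioo_subset_Icc_self))
      hprod.integral_prod_left hEm fun t ht => ?_
    simp only [projIcc_of_mem hss' (Ioo_subset_Icc_self ht.1)]
    exact hW.rate_le t (hsub (Ioo_subset_Icc_self ht.1))
  have hWi : Integrable (fun x => W s' x - W s x) μ := (hW.integrable hs').sub (hW.integrable hs)
  have hfatou := tsum_le_integral_of_hasSum (μ := μ)
    (R := fun (q : S) x => W q.1.2 x - W q.1.1 x)
    (fun q => (hW.integrable (hq2 q)).sub (hW.integrable (hq1 q)))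
    (hWi.sub hTi) hsum
    (fun q => by
      rw [integral_sub (hW.integrable (hq2 q)) (hW.integrable (hq1 q))]
      exact hflow q W W' c hW)
    (fun q => hA.integral_max_le (hq1 q) (hq2 q) (hq q).2.1.le (hq q).2.2.2.2 (hflow q) hW)
    hsumc.summable hsuml
  rw [hsumc.tsum_eq] at hfatou
  simp only [Pi.sub_apply] at hfatou
  rw [integral_sub hWi hTi] at hfatou
  rw [integral_sub (hW.integrable hs') (hW.integrable hs)] at hfatou
  have h2 := integral_inter_add_sdiff (μ := volume) (f := c) (s := Ioo s s')
    hZ.measurableSet (hci.mono_set Ioo_subset_Icc_self)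
  rw [intervalIntegral.integral_of_le hss', integral_Ioc_eq_integral_Ioo]
  linarith

/-- Integration of the pointwise-in-time inequality, without any local boundedness of `m'`:
a Baire category argument on the closed set of times around which the conclusion fails. -/
theorem flowMono_of_hasAnchors [IsFiniteMeasure μ] (hαβ : α ≤ β)
    (hcont : ∀ x, ContinuousOn (fun t => m' t x) (Icc α β))
    (hbdd : ∀ t ∈ Icc α β, ∃ N : ℝ, ∀ x, |m' t x| ≤ N)
    (hA : ∀ N, ∃ C, HasAnchors μ α β m m' N C) : FlowMono μ α β m m' α β := by
  set P : ℝ → ℝ → Prop := fun t r => ∀ s ∈ Icc α β, ∀ s' ∈ Icc α β, s ≤ s' → t - r < s →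
    s' < t + r → FlowMono μ α β m m' s s' with hP
  set Z : Set ℝ := {t ∈ Icc α β | ¬ ∃ r > 0, P t r} with hZdef
  have hZc : IsClosed Z := by
    have : Z = Icc α β \ {t | ∃ r > 0, P t r} := rfl
    rw [this]
    refine isClosed_Icc.sdiff ?_
    rw [Metric.isOpen_iff]
    rintro t ⟨r, hr, hPr⟩
    refine ⟨r / 2, half_pos hr, fun t' ht' => ⟨r / 2, half_pos hr, fun s hs s' hs' hss h1 h2 => ?_⟩⟩
    rw [Metric.mem_ball, Real.dist_eq, abs_lt] at ht'
    exact hPr s hs s' hs' hss (by linarith) (by linarith)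
  have hgap : ∀ a ∈ Icc α β, ∀ b ∈ Icc α β, a < b → Disjoint (Ioo a b) Z →
      FlowMono μ α β m m' a b := by
    intro a ha b hb hab hd
    refine .of_Ioo ha hb hab fun s t has hst htb => ?_
    have hs : s ∈ Icc α β := ⟨ha.1.trans has.le, (hst.trans htb.le).trans hb.2⟩
    have ht : t ∈ Icc α β := ⟨ha.1.trans (has.le.trans hst), htb.le.trans hb.2⟩
    refine .of_locally hs ht hst fun τ hτ => ?_
    by_contra hno
    exact disjoint_left.1 hd ⟨has.trans_le hτ.1, hτ.2.trans_lt htb⟩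
      ⟨⟨hs.1.trans hτ.1, hτ.2.trans ht.2⟩, hno⟩
  rcases Z.eq_empty_or_nonempty with hZe | hZne
  · rcases hαβ.eq_or_lt with h | h
    · rw [← h]; exact .refl _
    · exact hgap _ (left_mem_Icc.2 hαβ) _ (right_mem_Icc.2 hαβ) h (by simp [hZe])
  · exfalso
    have : Nonempty Z := hZne.to_subtype
    have : CompleteSpace Z := hZc.isComplete.completeSpace_coe
    obtain ⟨k, z, hz⟩ := nonempty_interior_of_iUnion_of_closed
      (f := fun k : ℕ => {t : Z | ∀ x, |m' t x| ≤ k}) (fun k => by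
        simp only [ofPred_forall]
        refine isClosed_iInter fun x => isClosed_le (Continuous.abs ?_) continuous_const
        exact (hcont x).comp_continuous continuous_subtype_val fun t => t.2.1) (by
        refine eq_univ_of_forall fun t => ?_
        obtain ⟨N, hN⟩ := hbdd t t.2.1
        obtain ⟨k, hk⟩ := exists_nat_ge N
        exact mem_iUnion.2 ⟨k, fun x => (hN x).trans hk⟩)
    obtain ⟨r, hr, hball⟩ := Metric.mem_nhds_iff.1 (mem_interior_iff_mem_nhds.1 hz)
    refine z.2.2 ⟨r, hr, fun s hs s' hs' hss h1 h2 => ?_⟩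
    obtain ⟨Ns, hNs⟩ := hbdd s hs
    obtain ⟨C, hC⟩ := hA (max k Ns)
    refine .of_bounded_on_closed hC hs hs' hss hZc (fun t ht x => ?_)
      (fun x => (hNs x).trans (le_max_right _ _))
      fun a b hsa hab hbs => hgap a ⟨hs.1.trans hsa, (hab.le.trans hbs).trans hs'.2⟩
        b ⟨hs.1.trans (hsa.trans hab.le), hbs.trans hs'.2⟩ hab
    refine le_trans ?_ (le_max_left _ _)
    have : (⟨t, ht.1⟩ : Z) ∈ Metric.ball z r := by
      rw [Metric.mem_ball, Subtype.dist_eq, Real.dist_eq, abs_lt]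
      constructor <;> linarith [ht.2.1, ht.2.2]
    exact hball this x

end LowerFlow

section Cutoff

variable {X : Type*} [TopologicalSpace X] {Ω K : Set X}

theorem ContinuousOn.continuous_of_eq_zero {Y : Type*} [TopologicalSpace Y] [Zero Y]
    {f : X → Y} (hf : ContinuousOn f Ω) (hΩ : IsOpen Ω)
    (hK : IsClosed K) (hKΩ : K ⊆ Ω) (h0 : ∀ x ∉ K, f x = 0) : Continuous f :=
  hf.continuous_of_tsupport_subset hΩ
    ((closure_minimal (Function.support_subset_iff'.2 h0) hK).trans hKΩ)

variable [T2Space X] [MeasurableSpace X] [OpensMeasurableSpace X] {μ : Measure X}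
  [IsFiniteMeasureOnCompacts μ]

theorem ContinuousOn.integrable_of_eq_zero {f : X → ℝ} (hf : ContinuousOn f Ω) (hΩ : IsOpen Ω)
    (hK : IsCompact K) (hKΩ : K ⊆ Ω) (h0 : ∀ x ∉ K, f x = 0) : Integrable f μ :=
  (hf.continuous_of_eq_zero hΩ hK.isClosed hKΩ h0).integrable_of_hasCompactSupport
    (.intro hK h0)

end Cutoff

section Divergence

variable {n : ℕ} {Ω K : Set (EuclideanSpace ℝ (Fin n))}

theorem EuclideanSpace.sum_apply_single {F : Type*} [AddCommGroup F] [Module ℝ F]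
    [TopologicalSpace F] (L : EuclideanSpace ℝ (Fin n) →L[ℝ] F) (v : EuclideanSpace ℝ (Fin n)) :
    ∑ i, v i • L (EuclideanSpace.single i 1) = L v := by
  conv_rhs => rw [← (EuclideanSpace.basisFun (Fin n) ℝ).sum_repr v]
  simp [map_sum]

/-- Divergence theorem against a compactly supported test function. -/
theorem integral_mul_div_eq_neg (hΩ : IsOpen Ω) (hK : IsCompact K) (hKΩ : K ⊆ Ω)
    {F : EuclideanSpace ℝ (Fin n) → EuclideanSpace ℝ (Fin n)} (hF : ContDiffOn ℝ 1 F Ω)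
    {h : EuclideanSpace ℝ (Fin n) → ℝ} (hh : ContDiffOn ℝ 1 h Ω) (h0 : ∀ x ∉ K, h x = 0) :
    ∫ x, h x * ∑ i, fderiv ℝ F x (EuclideanSpace.single i 1) i = -∫ x, fderiv ℝ h x (F x) := by
  have hev : ∀ x ∉ K, h =ᶠ[𝓝 x] 0 := fun x hx =>
    (hK.isClosed.isOpen_compl.eventually_mem hx).mono h0
  have hd0 : ∀ x ∉ K, fderiv ℝ h x = 0 := fun x hx => by
    rw [(hev x hx).fderiv_eq]; simp
  have hdiff : Differentiable ℝ h := fun x => by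
    by_cases hx : x ∈ K
    · exact (hh.differentiableOn one_ne_zero).differentiableAt (hΩ.mem_nhds (hKΩ hx))
    · exact (differentiableAt_const (0 : ℝ)).congr_of_eventuallyEq (hev x hx)
  have hFd : ∀ x ∈ Ω, DifferentiableAt ℝ F x := fun x hx =>
    (hF.differentiableOn one_ne_zero).differentiableAt (hΩ.mem_nhds hx)
  have hF' : ContinuousOn (fderiv ℝ F) Ω := hF.continuousOn_fderiv_of_isOpen hΩ le_rfl
  have hh' : ContinuousOn (fderiv ℝ h) Ω := hh.continuousOn_fderiv_of_isOpen hΩ le_rfl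
  have hFi : ∀ i, ContinuousOn (fun x => F x i) Ω := fun i =>
    (EuclideanSpace.proj (𝕜 := ℝ) i).continuous.comp_continuousOn hF.continuousOn
  have hFi' : ∀ i, ContinuousOn (fun x => fderiv ℝ F x (EuclideanSpace.single i 1) i) Ω :=
    fun i => (EuclideanSpace.proj (𝕜 := ℝ) i).continuous.comp_continuousOn
      (hF'.clm_apply continuousOn_const)
  have hder : ∀ i, ∀ x ∈ Ω, fderiv ℝ (fun x => F x i) x (EuclideanSpace.single i 1) =
      fderiv ℝ F x (EuclideanSpace.single i 1) i := fun i x hx => by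
    have := ((EuclideanSpace.proj i : EuclideanSpace ℝ (Fin n) →L[ℝ] ℝ).hasFDerivAt.comp x
      (hFd x hx).hasFDerivAt).fderiv
    exact congrArg (fun L => L (EuclideanSpace.single i 1)) this
  have hmul : ∀ i x, h x * fderiv ℝ (fun x => F x i) x (EuclideanSpace.single i 1) =
      h x * fderiv ℝ F x (EuclideanSpace.single i 1) i := fun i x => by
    by_cases hx : x ∈ K
    · rw [hder i x (hKΩ hx)]
    · simp [h0 x hx]
  have hi1 : ∀ i, Integrable (fun x => h x * fderiv ℝ F x (EuclideanSpace.single i 1) i) :=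
    fun i => (hh.continuousOn.mul (hFi' i)).integrable_of_eq_zero hΩ hK hKΩ
      fun x hx => by simp [h0 x hx]
  have hi2 : ∀ i, Integrable (fun x => fderiv ℝ h x (EuclideanSpace.single i 1) * F x i) :=
    fun i => ((hh'.clm_apply continuousOn_const).mul (hFi i)).integrable_of_eq_zero hΩ hK hKΩ
      fun x hx => by simp [hd0 x hx]
  have hi3 : ∀ i, Integrable (fun x => h x * F x i) :=
    fun i => (hh.continuousOn.mul (hFi i)).integrable_of_eq_zero hΩ hK hKΩ
      fun x hx => by simp [h0 x hx]
  have hts : tsupport h ⊆ K :=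
    closure_minimal (Function.support_subset_iff'.2 h0) hK.isClosed
  have hparts : ∀ i, ∫ x, h x * fderiv ℝ F x (EuclideanSpace.single i 1) i =
      -∫ x, fderiv ℝ h x (EuclideanSpace.single i 1) * F x i := fun i => by
    rw [← integral_mul_fderiv_eq_neg_fderiv_mul_of_integrable (hi2 i)
      (by simpa only [hmul] using hi1 i) (hi3 i) (fun x _ => hdiff x) fun x hx =>
        (EuclideanSpace.proj (𝕜 := ℝ) i).differentiableAt.comp x (hFd x (hKΩ (hts hx)))]
    simp only [hmul]
  simp_rw [Finset.mul_sum]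
  rw [integral_finsetSum _ fun i _ => hi1 i, Finset.sum_congr rfl fun i _ => hparts i,
    Finset.sum_neg_distrib, ← integral_finsetSum _ fun i _ => hi2 i]
  congr 1
  refine integral_congr_ae (ae_of_all _ fun x => ?_)
  refine Eq.trans ?_ (EuclideanSpace.sum_apply_single (fderiv ℝ h x) (F x))
  exact Finset.sum_congr rfl fun i _ => mul_comm _ _

end Divergence

section Pointwise

theorem Real.mul_rpow_sub_one_mul_le {p a b : ℝ} (hp : 1 < p) (ha : 0 ≤ a) (hb : 0 ≤ b) :
    p * a ^ (p - 1) * b ≤ (p - 1) * a ^ p + b ^ p := by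
  have hc : (p / (p - 1)).HolderConjugate p := (Real.HolderConjugate.conjExponent hp).symm
  have hp1 : 0 < p - 1 := by linarith
  have := Real.young_inequality_of_nonneg (Real.rpow_nonneg ha (p - 1)) hb hc
  rw [← Real.rpow_mul ha, show (p - 1) * (p / (p - 1)) = p by field_simp] at this
  have h2 := mul_le_mul_of_nonneg_left this (by linarith : 0 ≤ p)
  have h3 : p * (a ^ p / (p / (p - 1)) + b ^ p / p) = (p - 1) * a ^ p + b ^ p := by
    field_simp
  linarith

variable {H : Type*} [NormedAddCommGroup H] [InnerProductSpace ℝ H]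

theorem norm_rpow_sub_two_smul {p : ℝ} (hp : 1 < p) (a : H) :
    ‖‖a‖ ^ (p - 2) • a‖ = ‖a‖ ^ (p - 1) := by
  rw [norm_smul, Real.norm_of_nonneg (by positivity)]
  rcases eq_or_ne a 0 with rfl | ha
  · simp [Real.zero_rpow (by linarith : p - 1 ≠ 0)]
  · rw [← Real.rpow_add_one (norm_ne_zero_iff.2 ha)]
    ring_nf

theorem inner_rpow_sub_two_smul_self {p : ℝ} (hp : 1 < p) (a : H) :
    inner ℝ (‖a‖ ^ (p - 2) • a) a = ‖a‖ ^ p := by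
  rw [real_inner_smul_left, real_inner_self_eq_norm_sq]
  rcases eq_or_ne a 0 with rfl | ha
  · simp [Real.zero_rpow (by linarith : p ≠ 0)]
  · rw [← Real.rpow_natCast, ← Real.rpow_add (norm_pos_iff.2 ha)]
    simp

/-- Monotonicity of the `p`-Laplacian vector field. -/
theorem inner_rpow_sub_two_smul_sub_nonneg {p : ℝ} (hp : 1 < p) (a b : H) :
    0 ≤ inner ℝ (‖a‖ ^ (p - 2) • a - ‖b‖ ^ (p - 2) • b) (a - b) := by
  have h1 : inner ℝ (‖a‖ ^ (p - 2) • a) b ≤ ‖a‖ ^ (p - 1) * ‖b‖ := by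
    rw [← norm_rpow_sub_two_smul hp a]; exact real_inner_le_norm _ _
  have h2 : inner ℝ (‖b‖ ^ (p - 2) • b) a ≤ ‖b‖ ^ (p - 1) * ‖a‖ := by
    rw [← norm_rpow_sub_two_smul hp b]; exact real_inner_le_norm _ _
  have h3 : ∀ c : H, ‖c‖ ^ p = ‖c‖ ^ (p - 1) * ‖c‖ := fun c => by
    rw [← Real.rpow_add_one' (norm_nonneg c) (by linarith)]; ring_nf
  have h4 : 0 ≤ (‖a‖ ^ (p - 1) - ‖b‖ ^ (p - 1)) * (‖a‖ - ‖b‖) := by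
    rcases le_total ‖a‖ ‖b‖ with h | h
    · exact mul_nonneg_of_nonpos_of_nonpos
        (sub_nonpos.2 (Real.rpow_le_rpow (norm_nonneg _) h (by linarith))) (sub_nonpos.2 h)
    · exact mul_nonneg
        (sub_nonneg.2 (Real.rpow_le_rpow (norm_nonneg _) h (by linarith))) (sub_nonneg.2 h)
  rw [inner_sub_left, inner_sub_right, inner_sub_right, inner_rpow_sub_two_smul_self hp,
    inner_rpow_sub_two_smul_self hp, h3 a, h3 b]
  linarith

end Pointwise

section WeightedIdentity

variable {n : ℕ} {Ω K : Set (EuclideanSpace ℝ (Fin n))} {p : ℝ}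
  {w ζ P φ : EuclideanSpace ℝ (Fin n) → ℝ}

/-- The logarithmic gradient `∇w / w`. -/
noncomputable def logGrad (w : EuclideanSpace ℝ (Fin n) → ℝ) (x : EuclideanSpace ℝ (Fin n)) :
    EuclideanSpace ℝ (Fin n) :=
  (w x)⁻¹ • gradient w x

/-- The field `‖∇w / w‖^{p-2} ∇w / w`. -/
noncomputable def logField (p : ℝ) (w : EuclideanSpace ℝ (Fin n) → ℝ)
    (x : EuclideanSpace ℝ (Fin n)) : EuclideanSpace ℝ (Fin n) :=
  ‖logGrad w x‖ ^ (p - 2) • logGrad w x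

/-- The rescaled `p`-Laplacian `w^{1-p} Δ_p w`. -/
noncomputable def scaledLap (p : ℝ) (w : EuclideanSpace ℝ (Fin n) → ℝ)
    (x : EuclideanSpace ℝ (Fin n)) : ℝ :=
  w x ^ (1 - p) * pLaplacian p w x

/-- Positive functions on `Ω` regular enough for the `p`-Laplacian to be classical. -/
structure IsPosRegular (Ω : Set (EuclideanSpace ℝ (Fin n))) (p : ℝ)
    (w : EuclideanSpace ℝ (Fin n) → ℝ) : Prop where
  pos : ∀ x ∈ Ω, 0 < w x
  contDiffOn : ContDiffOn ℝ 2 w Ω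
  contDiffOn_pVF : ContDiffOn ℝ 1 (pVF p w) Ω

theorem eventuallyEq_zero_of_notMem (hK : IsCompact K) (h0 : ∀ x ∉ K, P x = 0) :
    ∀ x ∉ K, P =ᶠ[𝓝 x] 0 :=
  fun _ hx => (hK.isClosed.isOpen_compl.eventually_mem hx).mono h0

theorem fderiv_eq_zero_of_notMem (hK : IsCompact K) (h0 : ∀ x ∉ K, P x = 0) :
    ∀ x ∉ K, fderiv ℝ P x = 0 := fun x hx => by
  rw [(eventuallyEq_zero_of_notMem hK h0 x hx).fderiv_eq]; simp

theorem norm_gradient (f : EuclideanSpace ℝ (Fin n) → ℝ) (x : EuclideanSpace ℝ (Fin n)) :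
    ‖gradient f x‖ = ‖fderiv ℝ f x‖ := by
  simp [gradient]

theorem pVF_eq (hw : 0 < w x) : pVF p w x = w x ^ (p - 1) • logField p w x := by
  have h1 : gradient w x = w x • logGrad w x := by
    rw [logGrad, smul_smul, mul_inv_cancel₀ hw.ne', one_smul]
  rw [pVF, logField, h1, norm_smul, Real.norm_of_nonneg hw.le,
    Real.mul_rpow hw.le (norm_nonneg _), smul_smul, smul_smul]
  congr 1
  rw [show p - 1 = p - 2 + 1 by ring, Real.rpow_add_one hw.ne']
  ring

theorem logField_eq {x : EuclideanSpace ℝ (Fin n)} (hw : 0 < w x) :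
    logField p w x = w x ^ (1 - p) • pVF p w x := by
  rw [pVF_eq hw, smul_smul, ← Real.rpow_add hw]
  simp

namespace IsPosRegular

variable (hw : IsPosRegular Ω p w)
include hw

theorem contDiffOn_one : ContDiffOn ℝ 1 w Ω := hw.contDiffOn.of_le one_le_two

theorem continuousOn_logField : ContinuousOn (logField p w) Ω :=
  ((hw.contDiffOn_one.continuousOn.rpow_const fun x hx => .inl (hw.pos x hx).ne').smul
    hw.contDiffOn_pVF.continuousOn).congr fun x hx => logField_eq (hw.pos x hx)

theorem hasFDerivAt (hΩ : IsOpen Ω) {x : EuclideanSpace ℝ (Fin n)} (hx : x ∈ Ω) :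
    HasFDerivAt w (fderiv ℝ w x) x :=
  ((hw.contDiffOn_one.differentiableOn one_ne_zero).differentiableAt (hΩ.mem_nhds hx)).hasFDerivAt

theorem continuousOn_logGrad (hΩ : IsOpen Ω) : ContinuousOn (logGrad w) Ω :=
  (hw.contDiffOn_one.continuousOn.inv₀ fun x hx => (hw.pos x hx).ne').smul
    ((InnerProductSpace.toDual ℝ _).symm.continuous.comp_continuousOn
      (hw.contDiffOn_one.continuousOn_fderiv_of_isOpen hΩ le_rfl))

theorem continuousOn_scaledLap (hΩ : IsOpen Ω) : ContinuousOn (scaledLap p w) Ω := by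
  refine (hw.contDiffOn_one.continuousOn.rpow_const fun x hx => .inl (hw.pos x hx).ne').mul ?_
  exact continuousOn_finsetSum _ fun i _ =>
    (EuclideanSpace.proj (𝕜 := ℝ) i).continuous.comp_continuousOn
      ((hw.contDiffOn_pVF.continuousOn_fderiv_of_isOpen hΩ le_rfl).clm_apply continuousOn_const)

theorem fderiv_apply_pVF (hp : 1 < p) {x : EuclideanSpace ℝ (Fin n)} (hx : x ∈ Ω) :
    fderiv ℝ w x (logField p w x) = w x * ‖logGrad w x‖ ^ p := by
  have h0 := hw.pos x hx
  rw [← inner_gradient_left, show gradient w x = w x • logGrad w x by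
    rw [logGrad, smul_smul, mul_inv_cancel₀ h0.ne', one_smul], real_inner_smul_left,
    real_inner_comm, logField, inner_rpow_sub_two_smul_self hp]

/-- Integration by parts of `w^{1-p} Δ_p w` against `ζ P`. -/
theorem integral_mul_scaledLap (hΩ : IsOpen Ω) (hK : IsCompact K) (hKΩ : K ⊆ Ω) (hp : 1 < p)
    (hζ : ContDiffOn ℝ 1 ζ Ω) (hP : ContDiff ℝ 1 P) (h0 : ∀ x ∉ K, P x = 0) :
    ∫ x, P x * (ζ x * scaledLap p w x) = ∫ x, (P x * (ζ x * ((p - 1) * ‖logGrad w x‖ ^ p)) -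
      ζ x * fderiv ℝ P x (logField p w x) - P x * fderiv ℝ ζ x (logField p w x)) := by
  have hpow : ContDiffOn ℝ 1 (fun x => w x ^ (1 - p)) Ω :=
    hw.contDiffOn_one.rpow_const_of_ne fun x hx => (hw.pos x hx).ne'
  have := integral_mul_div_eq_neg hΩ hK hKΩ hw.contDiffOn_pVF
    (h := fun x => P x * (ζ x * w x ^ (1 - p))) (hP.contDiffOn.mul (hζ.mul hpow))
    fun x hx => by simp [h0 x hx]
  rw [← integral_neg] at this
  refine Eq.trans (integral_congr_ae (ae_of_all _ fun x => ?_)) (this.trans ?_)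
  · simp only [scaledLap, pLaplacian]; ring
  · refine integral_congr_ae (ae_of_all _ fun x => ?_)
    simp only
    by_cases hx : x ∈ K
    · have hx' := hKΩ hx
      have hwx := hw.pos x hx'
      have hζ' := ((hζ.differentiableOn one_ne_zero).differentiableAt
        (hΩ.mem_nhds hx')).hasFDerivAt
      have hP' := (hP.differentiable one_ne_zero x).hasFDerivAt
      have hd := hP'.mul (hζ'.mul ((hw.hasFDerivAt hΩ hx').rpow_const (p := 1 - p)
        (.inl hwx.ne')))
      have hd' := hd.fderiv
      rw [show fderiv ℝ (fun x => P x * (ζ x * w x ^ (1 - p))) x = _ from hd']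
      have h1 := hw.fderiv_apply_pVF hp hx'
      have h2 : w x ^ (1 - p - 1) * w x ^ (p - 1) * w x = 1 := by
        rw [← Real.rpow_add hwx, ← Real.rpow_add_one hwx.ne']
        ring_nf; simp
      have h3 : w x ^ (1 - p) * w x ^ (p - 1) = 1 := by
        rw [← Real.rpow_add hwx]; simp
      rw [pVF_eq hwx]
      simp only [map_smul, add_apply, smul_apply, smul_eq_mul, h1, Pi.mul_apply]
      linear_combination (-(1 - p) * P x * ζ x * ‖logGrad w x‖ ^ p) * h2 -
        (ζ x * fderiv ℝ P x (logField p w x) + P x * fderiv ℝ ζ x (logField p w x)) * h3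
    · rw [fderiv_eq_zero_of_notMem hK (P := fun x => P x * (ζ x * w x ^ (1 - p)))
        (fun x hx => by simp [h0 x hx]) x hx, fderiv_eq_zero_of_notMem hK h0 x hx]
      simp [h0 x hx]

end IsPosRegular

theorem abs_fderiv_abs_rpow_logField_le (hp : 1 < p) (hφ : ContDiff ℝ 1 φ)
    (x : EuclideanSpace ℝ (Fin n)) :
    |fderiv ℝ (fun x => |φ x| ^ p) x (logField p w x)| ≤
      p * (|φ x| * ‖logGrad w x‖) ^ (p - 1) * ‖gradient φ x‖ := by
  have h1 := norm_fderiv_norm_rpow_le (hφ.differentiable one_ne_zero) (x := x) hp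
  simp only [Real.norm_eq_abs] at h1
  rw [← Real.norm_eq_abs]
  refine (ContinuousLinearMap.le_opNorm _ _).trans ?_
  rw [logField, norm_rpow_sub_two_smul hp, norm_gradient,
    Real.mul_rpow (abs_nonneg _) (norm_nonneg _)]
  refine (mul_le_mul_of_nonneg_right h1 (by positivity)).trans (le_of_eq ?_)
  ring

theorem abs_fderiv_le_young (hp : 1 < p) (hφ : ContDiff ℝ 1 φ) (x : EuclideanSpace ℝ (Fin n)) :
    |fderiv ℝ (fun x => |φ x| ^ p) x (logField p w x)| ≤
      |φ x| ^ p * ((p - 1) * ‖logGrad w x‖ ^ p) + ‖gradient φ x‖ ^ p := by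
  refine (abs_fderiv_abs_rpow_logField_le hp hφ x).trans ?_
  refine (Real.mul_rpow_sub_one_mul_le hp (by positivity) (norm_nonneg _)).trans (le_of_eq ?_)
  rw [Real.mul_rpow (abs_nonneg _) (norm_nonneg _)]
  ring

theorem abs_fderiv_le_young_half (hp : 1 < p) (hφ : ContDiff ℝ 1 φ)
    (x : EuclideanSpace ℝ (Fin n)) :
    |fderiv ℝ (fun x => |φ x| ^ p) x (logField p w x)| ≤
      |φ x| ^ p * ((p - 1) / 2 * ‖logGrad w x‖ ^ p) +
        (2 ^ (p - 1)) ^ p * ‖gradient φ x‖ ^ p := by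
  refine (abs_fderiv_abs_rpow_logField_le hp hφ x).trans ?_
  have h0 : 0 ≤ |φ x| * ‖logGrad w x‖ := by positivity
  have h5 := Real.mul_rpow (z := p) (abs_nonneg (φ x)) (norm_nonneg (logGrad w x))
  generalize |φ x| * ‖logGrad w x‖ = s at h0 h5 ⊢
  have h1 := Real.mul_rpow_sub_one_mul_le hp (div_nonneg h0 zero_le_two)
    (b := 2 ^ (p - 1) * ‖gradient φ x‖) (by positivity)
  rw [Real.div_rpow h0 zero_le_two, Real.div_rpow h0 zero_le_two,
    Real.mul_rpow (by positivity) (norm_nonneg _)] at h1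
  have h2 : (2 : ℝ) ≤ 2 ^ p := by
    simpa using Real.rpow_le_rpow_of_exponent_le one_le_two hp.le
  have h3 : s ^ p / 2 ^ p ≤ s ^ p / 2 := by gcongr
  have h4 : (0 : ℝ) < 2 ^ (p - 1) := by positivity
  calc p * s ^ (p - 1) * ‖gradient φ x‖ = p * (s ^ (p - 1) / 2 ^ (p - 1)) *
        (2 ^ (p - 1) * ‖gradient φ x‖) := by field_simp
    _ ≤ _ := h1
    _ ≤ (p - 1) * (s ^ p / 2) + (2 ^ (p - 1)) ^ p * ‖gradient φ x‖ ^ p := by gcongr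
    _ = _ := by rw [h5]; ring

end WeightedIdentity

section FixedTime

variable {n : ℕ} {Ω K : Set (EuclideanSpace ℝ (Fin n))} {p : ℝ}
  {w U ζ φ : EuclideanSpace ℝ (Fin n) → ℝ}

theorem contDiff_abs_rpow (hp : 1 < p) (hφ : ContDiff ℝ 1 φ) :
    ContDiff ℝ 1 fun x => |φ x| ^ p := by
  simpa only [Real.norm_eq_abs] using hφ.norm_rpow hp

theorem continuous_norm_gradient_rpow (hp : 1 < p) (hφ : ContDiff ℝ 1 φ) :
    Continuous fun x => ‖gradient φ x‖ ^ p := by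
  simp_rw [norm_gradient]
  exact (hφ.continuous_fderiv one_ne_zero).norm.rpow_const fun _ => .inr (by linarith)

theorem abs_rpow_eq_zero_of_notMem (hp : 1 < p) (h0 : ∀ x ∉ K, φ x = 0) :
    ∀ x ∉ K, |φ x| ^ p = 0 := fun x hx => by
  rw [h0 x hx, abs_zero, Real.zero_rpow (by linarith)]

theorem norm_gradient_rpow_eq_zero_of_notMem (hp : 1 < p) (hK : IsCompact K)
    (h0 : ∀ x ∉ K, φ x = 0) : ∀ x ∉ K, ‖gradient φ x‖ ^ p = 0 := fun x hx => by
  rw [norm_gradient, fderiv_eq_zero_of_notMem hK h0 x hx, norm_zero,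
    Real.zero_rpow (by linarith)]

namespace IsPosRegular

theorem integrable_weighted (hw : IsPosRegular Ω p w) (hΩ : IsOpen Ω) (hK : IsCompact K)
    (hKΩ : K ⊆ Ω) (hp : 1 < p) (hζ : ContDiffOn ℝ 1 ζ Ω) (hφ : ContDiff ℝ 1 φ)
    (h0 : ∀ x ∉ K, φ x = 0) :
    Integrable fun x => |φ x| ^ p * (ζ x * ((p - 1) * ‖logGrad w x‖ ^ p)) -
      ζ x * fderiv ℝ (fun x => |φ x| ^ p) x (logField p w x) -
      |φ x| ^ p * fderiv ℝ ζ x (logField p w x) := by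
  have hP := contDiff_abs_rpow hp hφ
  have h0' := abs_rpow_eq_zero_of_notMem hp h0
  refine ContinuousOn.integrable_of_eq_zero (Ω := Ω) ?_ hΩ hK hKΩ fun x hx => ?_
  · refine ((hP.continuous.continuousOn.mul (hζ.continuousOn.mul (continuousOn_const.mul
      ((hw.continuousOn_logGrad hΩ).norm.rpow_const fun x hx => .inr (by linarith))))).sub
      (hζ.continuousOn.mul ((hP.continuous_fderiv one_ne_zero).continuousOn.clm_apply
        hw.continuousOn_logField))).sub (hP.continuous.continuousOn.mul
        ((hζ.continuousOn_fderiv_of_isOpen hΩ le_rfl).clm_apply hw.continuousOn_logField))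
  · simp [h0' x hx, fderiv_eq_zero_of_notMem hK h0' x hx]

theorem integrable_logGrad (hw : IsPosRegular Ω p w) (hΩ : IsOpen Ω) (hK : IsCompact K)
    (hKΩ : K ⊆ Ω) (hp : 1 < p) (hφ : ContDiff ℝ 1 φ) (h0 : ∀ x ∉ K, φ x = 0) :
    Integrable fun x => |φ x| ^ p * ((p - 1) * ‖logGrad w x‖ ^ p) := by
  refine ContinuousOn.integrable_of_eq_zero (Ω := Ω) ?_ hΩ hK hKΩ fun x hx => ?_
  · exact (contDiff_abs_rpow hp hφ).continuous.continuousOn.mul (continuousOn_const.mul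
      ((hw.continuousOn_logGrad hΩ).norm.rpow_const fun x hx => .inr (by linarith)))
  · simp [abs_rpow_eq_zero_of_notMem hp h0 x hx]

/-- Picone-type inequality with a weight decreasing along the gradient. -/
theorem neg_integral_le (hw : IsPosRegular Ω p w) (hΩ : IsOpen Ω) (hK : IsCompact K)
    (hKΩ : K ⊆ Ω) (hp : 1 < p) (hζ : ContDiffOn ℝ 1 ζ Ω) (hφ : ContDiff ℝ 1 φ)
    (h0 : ∀ x ∉ K, φ x = 0) (hζ0 : ∀ x ∈ Ω, 0 ≤ ζ x)
    (hζd : ∀ x ∈ Ω, fderiv ℝ ζ x (logField p w x) ≤ 0) :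
    -∫ x, ζ x * ‖gradient φ x‖ ^ p ≤ ∫ x, |φ x| ^ p * (ζ x * scaledLap p w x) := by
  have h0' := abs_rpow_eq_zero_of_notMem hp h0
  have hG0 := norm_gradient_rpow_eq_zero_of_notMem hp hK h0
  rw [hw.integral_mul_scaledLap hΩ hK hKΩ hp hζ (contDiff_abs_rpow hp hφ) h0', ← integral_neg]
  refine integral_mono (ContinuousOn.integrable_of_eq_zero (Ω := Ω)
    (hζ.continuousOn.mul (continuous_norm_gradient_rpow hp hφ).continuousOn).neg hΩ hK hKΩ
    fun x hx => by simp [hG0 x hx]) (hw.integrable_weighted hΩ hK hKΩ hp hζ hφ h0) fun x => ?_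
  simp only
  by_cases hx : x ∈ K
  · have hy := (abs_le.1 (abs_fderiv_le_young (w := w) hp hφ x)).2
    have h1 := mul_le_mul_of_nonneg_left hy (hζ0 x (hKΩ hx))
    have h2 := mul_nonpos_of_nonneg_of_nonpos
      (Real.rpow_nonneg (abs_nonneg (φ x)) p) (hζd x (hKΩ hx))
    linarith
  · simp [h0' x hx, fderiv_eq_zero_of_notMem hK h0' x hx, hG0 x hx]

theorem integral_logGrad_le (hU : IsPosRegular Ω p U) (hΩ : IsOpen Ω) (hK : IsCompact K)
    (hKΩ : K ⊆ Ω) (hp : 1 < p) (hφ : ContDiff ℝ 1 φ) (h0 : ∀ x ∉ K, φ x = 0) :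
    (∫ x, |φ x| ^ p * ((p - 1) * ‖logGrad U x‖ ^ p)) / 2 -
      (2 ^ (p - 1)) ^ p * ∫ x, ‖gradient φ x‖ ^ p ≤ ∫ x, |φ x| ^ p * scaledLap p U x := by
  have h0' := abs_rpow_eq_zero_of_notMem hp h0
  have hG0 := norm_gradient_rpow_eq_zero_of_notMem hp hK h0
  have hGi : Integrable fun x => ‖gradient φ x‖ ^ p :=
    (continuous_norm_gradient_rpow hp hφ).continuousOn.integrable_of_eq_zero hΩ hK hKΩ hG0
  have hSi := hU.integrable_logGrad hΩ hK hKΩ hp hφ h0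
  have hone : ContDiffOn ℝ 1 (fun _ : EuclideanSpace ℝ (Fin n) => (1 : ℝ)) Ω := contDiffOn_const
  have hI := hU.integral_mul_scaledLap hΩ hK hKΩ hp hone (contDiff_abs_rpow hp hφ) h0'
  have hi := hU.integrable_weighted hΩ hK hKΩ hp hone hφ h0
  simp only [one_mul, fderiv_fun_const, Pi.zero_apply, zero_apply, mul_zero, sub_zero] at hI hi
  rw [hI, ← integral_div, ← integral_const_mul, ← integral_sub (hSi.div_const 2)
    (hGi.const_mul _)]
  refine integral_mono ((hSi.div_const 2).sub (hGi.const_mul _)) hi fun x => ?_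
  have hy := (abs_le.1 (abs_fderiv_le_young_half (w := U) hp hφ x)).2
  simp only
  linarith

/-- Comparison of two rescaled `p`-Laplacians, by monotonicity of the `p`-Laplacian field. -/
theorem neg_le_integral_sub (hw : IsPosRegular Ω p w) (hU : IsPosRegular Ω p U) (hΩ : IsOpen Ω)
    (hK : IsCompact K) (hKΩ : K ⊆ Ω) (hp : 1 < p) (hζ : ContDiffOn ℝ 1 ζ Ω)
    (hφ : ContDiff ℝ 1 φ) (h0 : ∀ x ∉ K, φ x = 0) (hζ0 : ∀ x ∈ Ω, 0 ≤ ζ x)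
    (hζ1 : ∀ x ∈ Ω, ζ x ≤ 1)
    (hζd : ∀ x ∈ Ω, ∃ κ : ℝ, 0 ≤ κ ∧ ∀ v,
      fderiv ℝ ζ x v = κ * inner ℝ (logGrad U x - logGrad w x) v) :
    -(2 * (∫ x, ‖gradient φ x‖ ^ p) + 4 * ((∫ x, |φ x| ^ p * scaledLap p U x) +
      (2 ^ (p - 1)) ^ p * ∫ x, ‖gradient φ x‖ ^ p)) ≤
      (∫ x, |φ x| ^ p * (ζ x * scaledLap p w x)) -
        ∫ x, |φ x| ^ p * (ζ x * scaledLap p U x) := by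
  have hP := contDiff_abs_rpow hp hφ
  have h0' := abs_rpow_eq_zero_of_notMem hp h0
  have hG0 := norm_gradient_rpow_eq_zero_of_notMem hp hK h0
  have hGi : Integrable fun x => ‖gradient φ x‖ ^ p :=
    (continuous_norm_gradient_rpow hp hφ).continuousOn.integrable_of_eq_zero hΩ hK hKΩ hG0
  have hSi := hU.integrable_logGrad hΩ hK hKΩ hp hφ h0
  have hiw := hw.integrable_weighted hΩ hK hKΩ hp hζ hφ h0
  have hiU := hU.integrable_weighted hΩ hK hKΩ hp hζ hφ h0
  have hS := hU.integral_logGrad_le hΩ hK hKΩ hp hφ h0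
  have key : ∫ x, -(2 * ‖gradient φ x‖ ^ p +
      2 * (|φ x| ^ p * ((p - 1) * ‖logGrad U x‖ ^ p))) ≤
      (∫ x, |φ x| ^ p * (ζ x * scaledLap p w x)) -
        ∫ x, |φ x| ^ p * (ζ x * scaledLap p U x) := by
    rw [hw.integral_mul_scaledLap hΩ hK hKΩ hp hζ hP h0',
      hU.integral_mul_scaledLap hΩ hK hKΩ hp hζ hP h0', ← integral_sub hiw hiU]
    refine integral_mono ((hGi.const_mul 2).add (hSi.const_mul 2)).neg (hiw.sub hiU) fun x => ?_
    simp only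
    by_cases hx : x ∈ K
    · have hx' := hKΩ hx
      obtain ⟨κ, hκ, hd⟩ := hζd x hx'
      have hyw := (abs_le.1 (abs_fderiv_le_young (w := w) hp hφ x)).2
      have hyU := (abs_le.1 (abs_fderiv_le_young (w := U) hp hφ x)).1
      have hm := inner_rpow_sub_two_smul_sub_nonneg hp (logGrad w x) (logGrad U x)
      rw [real_inner_comm, ← neg_sub (logGrad U x), inner_neg_left, inner_sub_right] at hm
      have hm' := mul_nonneg (Real.rpow_nonneg (abs_nonneg (φ x)) p) (mul_nonneg hκ hm)
      rw [hd, hd]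
      have hG : 0 ≤ ‖gradient φ x‖ ^ p := by positivity
      have hSp : 0 ≤ |φ x| ^ p * ((p - 1) * ‖logGrad U x‖ ^ p) := by
        have : 0 < p - 1 := by linarith
        positivity
      have h1 := mul_le_mul_of_nonneg_left hyw (hζ0 x hx')
      have h2 := mul_le_mul_of_nonneg_left hyU (hζ0 x hx')
      have h3 := mul_le_mul_of_nonneg_right (hζ1 x hx') hG
      have h4 := mul_le_mul_of_nonneg_right (hζ1 x hx') hSp
      simp only [logField]
      simp only [logField] at h1 h2
      linarith
    · simp [h0' x hx, fderiv_eq_zero_of_notMem hK h0' x hx, hG0 x hx]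
  rw [integral_neg, integral_add (hGi.const_mul 2) (hSi.const_mul 2), integral_const_mul,
    integral_const_mul] at key
  linarith

end IsPosRegular

end FixedTime

section FlowConstruction

variable {X : Type*} [TopologicalSpace X] {Ω K : Set X} {α β : ℝ}

/-- Positive functions `v` of time and space, continuous in space, whose time derivative `g` is
separately continuous. -/
structure IsSeparatelyRegular (Ω : Set X) (α β : ℝ) (v g : ℝ → X → ℝ) : Prop where
  pos : ∀ t ∈ Icc α β, ∀ x ∈ Ω, 0 < v t x
  hasDerivAt : ∀ t ∈ Icc α β, ∀ x ∈ Ω, HasDerivAt (fun s => v s x) (g t x) t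
  continuousOn_time : ∀ x ∈ Ω, ContinuousOn (fun t => g t x) (Icc α β)
  continuousOn : ∀ t ∈ Icc α β, ContinuousOn (v t) Ω
  continuousOn_deriv : ∀ t ∈ Icc α β, ContinuousOn (g t) Ω

variable [T2Space X] [MeasurableSpace X] [OpensMeasurableSpace X] {μ : Measure X}

theorem IsSeparatelyRegular.isLowerFlow_comp {v g : ℝ → X → ℝ}
    (hv : IsSeparatelyRegular Ω α β v g) (hΩ : IsOpen Ω) (hK : IsCompact K) (hKΩ : K ⊆ Ω)
    {P : X → ℝ} (hP : Continuous P) (hP0 : ∀ x, 0 ≤ P x) (h0 : ∀ x ∉ K, P x = 0)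
    {Ψ ψ : X → ℝ → ℝ} (hΨ : ∀ x ∈ Ω, ∀ r > 0, HasDerivAt (Ψ x) (ψ x r) r)
    (hψ0 : ∀ x ∈ Ω, ∀ r > 0, 0 ≤ ψ x r) (hψ1 : ∀ x ∈ Ω, ∀ r > 0, ψ x r ≤ 1)
    (hψc : ∀ x ∈ Ω, ContinuousOn (ψ x) (Ioi 0))
    (hΨs : ∀ t ∈ Icc α β, ContinuousOn (fun x => Ψ x (v t x)) Ω)
    (hψs : ∀ t ∈ Icc α β, ContinuousOn (fun x => ψ x (v t x)) Ω) {M : ℝ} (hM0 : 0 ≤ M)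
    (hM : ∀ x ∈ Ω, ∀ r > 0, |P x * Ψ x r| ≤ M) {c : ℝ → ℝ} (hc : IntegrableOn c (Icc α β))
    (hcle : ∀ t ∈ Icc α β, c t ≤ ∫ x, P x * (ψ x (v t x) * g t x) ∂μ) :
    IsLowerFlow (μ.restrict K) α β (fun t x => P x * v t x) (fun t x => P x * g t x)
      (fun t x => P x * Ψ x (v t x)) (fun t x => P x * (ψ x (v t x) * g t x)) c where
  hasDeriv t ht x := by
    by_cases hx : x ∈ K
    · exact ((hΨ x (hKΩ hx) _ (hv.pos t ht x (hKΩ hx))).comp t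
        (hv.hasDerivAt t ht x (hKΩ hx))).const_mul (P x)
    · simpa [h0 x hx] using hasDerivAt_const t (0 : ℝ)
  cont x := by
    by_cases hx : x ∈ K
    · refine continuousOn_const.mul (.mul ?_ (hv.continuousOn_time x (hKΩ hx)))
      exact (hψc x (hKΩ hx)).comp (fun t ht =>
        (hv.hasDerivAt t ht x (hKΩ hx)).continuousAt.continuousWithinAt)
        fun t ht => hv.pos t ht x (hKΩ hx)
    · simpa [h0 x hx] using continuousOn_const
  meas t ht := (ContinuousOn.continuous_of_eq_zero (hP.continuousOn.mul (hΨs t ht)) hΩ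
    hK.isClosed hKΩ fun x hx => by simp [h0 x hx]).aestronglyMeasurable
  meas' t ht := (ContinuousOn.continuous_of_eq_zero (hP.continuousOn.mul ((hψs t ht).mul
    (hv.continuousOn_deriv t ht))) hΩ hK.isClosed hKΩ
    fun x hx => by simp [h0 x hx]).stronglyMeasurable
  bdd := ⟨M, fun t ht x => by
    by_cases hx : x ∈ K
    · exact hM x (hKΩ hx) _ (hv.pos t ht x (hKΩ hx))
    · simpa [h0 x hx] using hM0⟩
  deriv_le t ht x := by
    by_cases hx : x ∈ K
    · have hr := hv.pos t ht x (hKΩ hx)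
      rw [abs_mul, abs_mul, abs_mul, abs_of_nonneg (hψ0 x (hKΩ hx) _ hr)]
      exact mul_le_mul_of_nonneg_left
        (mul_le_of_le_one_left (abs_nonneg _) (hψ1 x (hKΩ hx) _ hr)) (abs_nonneg _)
    · simp [h0 x hx]
  sub_le s hs t ht x := by
    by_cases hx : x ∈ K
    · have hx' := hKΩ hx
      have hs' := hv.pos s hs x hx'
      have ht' := hv.pos t ht x hx'
      have hcont : ContinuousOn (Ψ x) (Ioi 0) := fun r hr =>
        (hΨ x hx' r hr).continuousAt.continuousWithinAt
      have hdiff : DifferentiableOn ℝ (Ψ x) (interior (Ioi 0)) := fun r hr =>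
        (hΨ x hx' r (interior_subset hr)).differentiableAt.differentiableWithinAt
      rw [← mul_sub, ← mul_sub]
      rcases le_total (v s x) (v t x) with h | h
      · refine le_trans ?_ (le_max_right _ _)
        have hmono : MonotoneOn (Ψ x) (Ioi 0) := monotoneOn_of_deriv_nonneg (convex_Ioi 0) hcont
          hdiff fun r hr => by
            rw [(hΨ x hx' r (interior_subset hr)).deriv]
            exact hψ0 x hx' r (interior_subset hr)
        exact mul_nonpos_of_nonneg_of_nonpos (hP0 x) (sub_nonpos.2 (hmono hs' ht' h))
      · refine le_trans ?_ (le_max_left _ _)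
        have := (convex_Ioi (0 : ℝ)).image_sub_le_mul_sub_of_deriv_le hcont hdiff (C := 1)
          (fun r hr => by
            rw [(hΨ x hx' r (interior_subset hr)).deriv]
            exact hψ1 x hx' r (interior_subset hr)) _ ht' _ hs' h
        exact mul_le_mul_of_nonneg_left (by simpa using this) (hP0 x)
    · simp [h0 x hx]
  rate := hc
  rate_le t ht := by
    rw [setIntegral_eq_integral_of_forall_compl_eq_zero fun x hx => by simp [h0 x hx]]
    exact hcle t ht

end FlowConstruction

section Softplus

/-- A smooth increasing convex approximation of the positive part. -/
noncomputable def softplus (d r : ℝ) : ℝ := d * Real.log (1 + Real.exp (r / d))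

theorem hasDerivAt_softplus {d : ℝ} (hd : 0 < d) (r : ℝ) :
    HasDerivAt (softplus d) (Real.sigmoid (r / d)) r := by
  have h := ((((hasDerivAt_id r).div_const d).exp.const_add 1).log
    (by positivity : (1 : ℝ) + Real.exp (r / d) ≠ 0)).const_mul d
  refine h.congr_deriv ?_
  rw [Real.sigmoid_def, Real.exp_neg]
  have := Real.exp_pos (r / d)
  simp only [id]
  field_simp
  ring

theorem max_le_softplus {d : ℝ} (hd : 0 < d) (r : ℝ) : max r 0 ≤ softplus d r := by
  have := Real.exp_pos (r / d)
  refine max_le ?_ (mul_nonneg hd.le (Real.log_nonneg (by linarith)))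
  calc r = d * Real.log (Real.exp (r / d)) := by rw [Real.log_exp]; field_simp
    _ ≤ _ := mul_le_mul_of_nonneg_left (Real.log_le_log this (by linarith)) hd.le

theorem softplus_mono {d : ℝ} (hd : 0 < d) : Monotone (softplus d) := by
  refine monotone_of_deriv_nonneg (fun r => (hasDerivAt_softplus hd r).differentiableAt) fun r => ?_
  rw [(hasDerivAt_softplus hd r).deriv]
  exact Real.sigmoid_nonneg _

theorem softplus_zero (d : ℝ) : softplus d 0 = d * Real.log 2 := by
  norm_num [softplus]

end Softplus

section Flows

variable {n : ℕ} {Ω K : Set (EuclideanSpace ℝ (Fin n))} {p α β : ℝ}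
  {w U V φ : EuclideanSpace ℝ (Fin n) → ℝ} {u : ℝ → EuclideanSpace ℝ (Fin n) → ℝ}

/-- The power `w^{2-p} / (2-p)`, whose gradient is `w^{1-p} ∇w`. -/
noncomputable def powerPotential (p : ℝ) (w : EuclideanSpace ℝ (Fin n) → ℝ)
    (x : EuclideanSpace ℝ (Fin n)) : ℝ :=
  w x ^ (2 - p) / (2 - p)

namespace IsPosRegular

theorem powerPotential_pos (hw : IsPosRegular Ω p w) (hp2 : p < 2) :
    ∀ x ∈ Ω, 0 < powerPotential p w x := fun x hx =>
  div_pos (Real.rpow_pos_of_pos (hw.pos x hx) _) (by linarith)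

theorem contDiffOn_powerPotential (hw : IsPosRegular Ω p w) :
    ContDiffOn ℝ 1 (powerPotential p w) Ω :=
  (hw.contDiffOn_one.rpow_const_of_ne fun x hx => (hw.pos x hx).ne').div_const _

theorem hasFDerivAt_powerPotential (hw : IsPosRegular Ω p w) (hΩ : IsOpen Ω) (hp2 : p < 2)
    {x : EuclideanSpace ℝ (Fin n)} (hx : x ∈ Ω) :
    HasFDerivAt (powerPotential p w) ((powerPotential p w x * (2 - p)) •
      innerSL ℝ (logGrad w x)) x := by
  have h0 := hw.pos x hx
  have hp : (2 - p) ≠ 0 := by linarith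
  have h := ((hw.hasFDerivAt hΩ hx).rpow_const (p := 2 - p) (.inl h0.ne')).mul_const (2 - p)⁻¹
  have h' : HasFDerivAt (powerPotential p w) _ x := h
  refine h'.congr_fderiv ?_
  ext y
  simp only [smul_apply, smul_eq_mul, innerSL_apply_apply, logGrad, real_inner_smul_left,
    inner_gradient_left, powerPotential]
  rw [Real.rpow_sub_one h0.ne']
  field_simp

end IsPosRegular

theorem hasDerivAt_div_one_add_mul {ε r : ℝ} (hε : 0 < ε) (hr : 0 < r) :
    HasDerivAt (fun r => r / (1 + ε * r)) ((1 + ε * r) ^ 2)⁻¹ r := by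
  have h0 : 1 + ε * r ≠ 0 := by positivity
  refine ((hasDerivAt_id r).div (((hasDerivAt_id r).const_mul ε).const_add 1) h0).congr_deriv ?_
  simp only [id]
  field_simp
  ring

theorem hasDerivAt_inv_sq_one_add_mul {ε r : ℝ} (hε : 0 < ε) (hr : 0 < r) :
    HasDerivAt (fun r => ((1 + ε * r) ^ 2)⁻¹) (-(2 * ε / (1 + ε * r) ^ 3)) r := by
  have h0 : 1 + ε * r ≠ 0 := by positivity
  refine (((((hasDerivAt_id r).const_mul ε).const_add 1).pow 2).inv
    (pow_ne_zero 2 h0)).congr_deriv ?_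
  simp only [id, Pi.pow_apply]
  field_simp
  norm_num
  ring

theorem integrable_abs_rpow_mul (hΩ : IsOpen Ω) (hK : IsCompact K) (hKΩ : K ⊆ Ω) (hp : 1 < p)
    (hφ : ContDiff ℝ 1 φ) (h0 : ∀ x ∉ K, φ x = 0) {f : EuclideanSpace ℝ (Fin n) → ℝ}
    (hf : ContinuousOn f Ω) : Integrable fun x => |φ x| ^ p * f x :=
  ContinuousOn.integrable_of_eq_zero ((contDiff_abs_rpow hp hφ).continuous.continuousOn.mul hf)
    hΩ hK hKΩ fun x hx => by simp [abs_rpow_eq_zero_of_notMem hp h0 x hx]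

/-- The weighted potential energy to which the equation is tested. -/
noncomputable def dampedEnergy (p : ℝ) (V φ : EuclideanSpace ℝ (Fin n) → ℝ)
    (u : ℝ → EuclideanSpace ℝ (Fin n) → ℝ) (ε t : ℝ) : ℝ :=
  ∫ x, ((1 + ε * powerPotential p (u t) x) ^ 2)⁻¹ * (|φ x| ^ p * V x - ‖gradient φ x‖ ^ p)

theorem isLowerFlow_damped (hΩ : IsOpen Ω) (hK : IsCompact K) (hKΩ : K ⊆ Ω) (hp : 1 < p)
    (hp2 : p < 2) (hV : ContinuousOn V Ω) (hφ : ContDiff ℝ 1 φ) (h0 : ∀ x ∉ K, φ x = 0)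
    (hu : ∀ t ∈ Icc α β, IsPosRegular Ω p (u t))
    (hv : IsSeparatelyRegular Ω α β (fun t => powerPotential p (u t))
      fun t x => scaledLap p (u t) x + V x) {ε : ℝ} (hε : 0 < ε) :
    IsLowerFlow (volume.restrict K) α β (fun t x => |φ x| ^ p * powerPotential p (u t) x)
      (fun t x => |φ x| ^ p * (scaledLap p (u t) x + V x))
      (fun t x => |φ x| ^ p * (powerPotential p (u t) x / (1 + ε * powerPotential p (u t) x)))
      (fun t x => |φ x| ^ p * (((1 + ε * powerPotential p (u t) x) ^ 2)⁻¹ *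
        (scaledLap p (u t) x + V x)))
      (dampedEnergy p V φ u ε) := by
  have hP := contDiff_abs_rpow hp hφ
  have h0' := abs_rpow_eq_zero_of_notMem hp h0
  have hG := continuous_norm_gradient_rpow hp hφ
  have hG0 := norm_gradient_rpow_eq_zero_of_notMem hp hK h0
  have hden : ∀ t ∈ Icc α β, ∀ x ∈ Ω, 1 + ε * powerPotential p (u t) x ≠ 0 := fun t ht x hx =>
    (add_pos one_pos (mul_pos hε (hv.pos t ht x hx))).ne'
  have hζ : ∀ t ∈ Icc α β,
      ContDiffOn ℝ 1 (fun x => ((1 + ε * powerPotential p (u t) x) ^ 2)⁻¹) Ω := fun t ht =>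
    ((contDiffOn_const.add (contDiffOn_const.mul (hu t ht).contDiffOn_powerPotential)).pow 2).inv
      fun x hx => pow_ne_zero 2 (hden t ht x hx)
  have hle1 : ∀ r > 0, ((1 + ε * r) ^ 2)⁻¹ ≤ 1 := fun r hr => by
    refine inv_le_one_of_one_le₀ (one_le_pow₀ ?_)
    have := mul_pos hε hr
    linarith
  have hVG : ContinuousOn (fun x => |φ x| ^ p * V x - ‖gradient φ x‖ ^ p) Ω :=
    (hP.continuous.continuousOn.mul hV).sub hG.continuousOn
  have hVG0 : ∀ x ∉ K, |φ x| ^ p * V x - ‖gradient φ x‖ ^ p = 0 := fun x hx => by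
    simp [h0' x hx, hG0 x hx]
  obtain ⟨M, hM⟩ := (hP.continuous.continuousOn.continuous_of_eq_zero hΩ hK.isClosed hKΩ
    h0').bounded_above_of_compact_support (.intro hK h0')
  refine hv.isLowerFlow_comp hΩ hK hKΩ hP.continuous (fun x => by positivity) h0'
    (Ψ := fun _ r => r / (1 + ε * r)) (ψ := fun _ r => ((1 + ε * r) ^ 2)⁻¹)
    (fun x _ r hr => hasDerivAt_div_one_add_mul hε hr) (fun x _ r hr => by positivity)
    (fun x _ r hr => hle1 r hr) (fun x _ r hr =>
      (hasDerivAt_inv_sq_one_add_mul hε hr).continuousAt.continuousWithinAt)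
    (fun t ht => (hv.continuousOn t ht).div (continuousOn_const.add
      (continuousOn_const.mul (hv.continuousOn t ht))) (hden t ht))
    (fun t ht => (hζ t ht).continuousOn) (M := M / ε)
    (div_nonneg ((norm_nonneg _).trans (hM 0)) hε.le) (fun x _ r hr => ?_) ?_ fun t ht => ?_
  · have hr' : 0 < r := hr
    rw [abs_mul, abs_of_pos (div_pos hr' (by positivity)), div_eq_mul_inv M]
    refine mul_le_mul (hM x) ?_ (by positivity) ((norm_nonneg _).trans (hM 0))
    rw [div_le_iff₀ (by positivity)]
    field_simp
    linarith
  · refine ContinuousOn.integrableOn_Icc ?_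
    have hi : Integrable fun x => |φ x| ^ p * V x - ‖gradient φ x‖ ^ p :=
      hVG.integrable_of_eq_zero hΩ hK hKΩ hVG0
    refine continuousOn_of_dominated
      (bound := fun x => ‖|φ x| ^ p * V x - ‖gradient φ x‖ ^ p‖)
      (fun t ht => ?_) (fun t ht => ae_of_all _ fun x => ?_) hi.norm (ae_of_all _ fun x => ?_)
    · exact (((hζ t ht).continuousOn.mul hVG).continuous_of_eq_zero hΩ hK.isClosed hKΩ
        fun x hx => by simp [hVG0 x hx]).aestronglyMeasurable
    · by_cases hx : x ∈ K
      · have hr := hv.pos t ht x (hKΩ hx)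
        rw [norm_mul, Real.norm_of_nonneg (by positivity)]
        exact mul_le_of_le_one_left (norm_nonneg _) (hle1 _ hr)
      · simp [hVG0 x hx]
    · by_cases hx : x ∈ K
      · refine ContinuousOn.mul (fun t ht => ?_) continuousOn_const
        exact ((hasDerivAt_inv_sq_one_add_mul hε (hv.pos t ht x (hKΩ hx))).continuousAt.comp
          (f := fun t => powerPotential p (u t) x)
          (hv.hasDerivAt t ht x (hKΩ hx)).continuousAt).continuousWithinAt
      · simpa [hVG0 x hx] using continuousOn_const
  · have h1 := (hu t ht).neg_integral_le hΩ hK hKΩ hp (hζ t ht) hφ h0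
      (fun x hx => by positivity) fun x hx => by
        have hr := hv.pos t ht x hx
        have hd := ((hasDerivAt_inv_sq_one_add_mul hε hr).comp_hasFDerivAt x
          ((hu t ht).hasFDerivAt_powerPotential hΩ hp2 hx)).fderiv
        rw [show fderiv ℝ (fun x => ((1 + ε * powerPotential p (u t) x) ^ 2)⁻¹) x = _ from hd]
        simp only [smul_apply, smul_eq_mul, innerSL_apply_apply]
        rw [real_inner_comm, logField, inner_rpow_sub_two_smul_self hp, neg_mul]
        have : 0 < 2 - p := by linarith
        rw [neg_nonpos]
        positivity
    have hi1 : Integrable fun x => |φ x| ^ p * (((1 + ε * powerPotential p (u t) x) ^ 2)⁻¹ *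
        scaledLap p (u t) x) := integrable_abs_rpow_mul hΩ hK hKΩ hp hφ h0
      ((hζ t ht).continuousOn.mul ((hu t ht).continuousOn_scaledLap hΩ))
    have hi2 : Integrable fun x => |φ x| ^ p * (((1 + ε * powerPotential p (u t) x) ^ 2)⁻¹ *
        V x) := integrable_abs_rpow_mul hΩ hK hKΩ hp hφ h0 ((hζ t ht).continuousOn.mul hV)
    have hi3 : Integrable fun x => ((1 + ε * powerPotential p (u t) x) ^ 2)⁻¹ *
        ‖gradient φ x‖ ^ p :=
      ((hζ t ht).continuousOn.mul hG.continuousOn).integrable_of_eq_zero hΩ hK hKΩ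
        fun x hx => by simp [hG0 x hx]
    calc dampedEnergy p V φ u ε t = (∫ x, |φ x| ^ p *
          (((1 + ε * powerPotential p (u t) x) ^ 2)⁻¹ * V x)) -
          ∫ x, ((1 + ε * powerPotential p (u t) x) ^ 2)⁻¹ * ‖gradient φ x‖ ^ p := by
          rw [← integral_sub hi2 hi3, dampedEnergy]
          congr 1; ext x; ring
      _ ≤ (∫ x, |φ x| ^ p * (((1 + ε * powerPotential p (u t) x) ^ 2)⁻¹ *
          scaledLap p (u t) x)) + ∫ x, |φ x| ^ p *
          (((1 + ε * powerPotential p (u t) x) ^ 2)⁻¹ * V x) := by linarith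
      _ = _ := by
          rw [← integral_add hi1 hi2]
          congr 1; ext x; ring

end Flows

section Anchors

variable {n : ℕ} {Ω K : Set (EuclideanSpace ℝ (Fin n))} {p α β : ℝ}
  {w U V φ : EuclideanSpace ℝ (Fin n) → ℝ} {u : ℝ → EuclideanSpace ℝ (Fin n) → ℝ}

theorem hasDerivAt_neg_mul_softplus {d b : ℝ} (hd : 0 < d) (hb : b ≠ 0) (r : ℝ) :
    HasDerivAt (fun r => -(b * softplus d (1 - r / b))) (Real.sigmoid ((1 - r / b) / d)) r := by
  have h := (((hasDerivAt_softplus hd (1 - r / b)).comp r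
    (((hasDerivAt_id r).div_const b).const_sub 1)).const_mul b).neg
  refine h.congr_deriv ?_
  field_simp

theorem contDiffOn_sigmoid_ratio (hw : IsPosRegular Ω p w) (hU : IsPosRegular Ω p U)
    (hp2 : p < 2) (d : ℝ) :
    ContDiffOn ℝ 1 (fun x => Real.sigmoid ((1 - powerPotential p w x / powerPotential p U x) / d))
      Ω :=
  (contDiff_sigmoid.of_le le_top).comp_contDiffOn ((contDiffOn_const.sub
    (hw.contDiffOn_powerPotential.div hU.contDiffOn_powerPotential
      fun x hx => (hU.powerPotential_pos hp2 x hx).ne')).div_const d)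

theorem exists_fderiv_sigmoid_ratio (hw : IsPosRegular Ω p w) (hU : IsPosRegular Ω p U)
    (hΩ : IsOpen Ω) (hp2 : p < 2) {d : ℝ} (hd : 0 < d) {x : EuclideanSpace ℝ (Fin n)}
    (hx : x ∈ Ω) :
    ∃ κ : ℝ, 0 ≤ κ ∧ ∀ y,
      fderiv ℝ (fun x => Real.sigmoid ((1 - powerPotential p w x / powerPotential p U x) / d)) x y =
        κ * inner ℝ (logGrad U x - logGrad w x) y := by
  have h1 := hw.powerPotential_pos hp2 x hx
  have h2 := hU.powerPotential_pos hp2 x hx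
  set s := (1 - powerPotential p w x / powerPotential p U x) / d with hs
  have hq := (((hw.hasFDerivAt_powerPotential hΩ hp2 hx).mul
    ((hasDerivAt_inv h2.ne').comp_hasFDerivAt x
      (hU.hasFDerivAt_powerPotential hΩ hp2 hx))).const_sub 1).mul_const d⁻¹
  have h := (Real.hasDerivAt_sigmoid s).comp_hasFDerivAt x
    (f := fun x => (1 - powerPotential p w x * (powerPotential p U x)⁻¹) * d⁻¹) hq
  refine ⟨Real.sigmoid s * (1 - Real.sigmoid s) * (powerPotential p w x / powerPotential p U x) *
    (2 - p) / d, ?_, fun y => ?_⟩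
  · have := Real.sigmoid_nonneg s
    have := sub_nonneg.2 (Real.sigmoid_le_one s)
    have : 0 < 2 - p := by linarith
    positivity
  · have h' : HasFDerivAt (fun x => Real.sigmoid
        ((1 - powerPotential p w x / powerPotential p U x) / d)) _ x := h
    rw [h'.fderiv]
    simp only [smul_apply, neg_apply, add_apply, smul_eq_mul, innerSL_apply_apply, inner_sub_left]
    simp only [Function.comp_apply]
    field_simp
    ring

theorem abs_integral_le_of_abs_le {f : EuclideanSpace ℝ (Fin n) → ℝ} (hK : IsCompact K)
    (h0 : ∀ x ∉ K, f x = 0) {N : ℝ} (hN : ∀ x, |f x| ≤ N) : |∫ x, f x| ≤ N * volume.real K := by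
  rw [← setIntegral_eq_integral_of_forall_compl_eq_zero h0]
  exact norm_setIntegral_le_of_norm_le_const (f := f) hK.measure_lt_top fun x _ => hN x

theorem exists_hasAnchors (hΩ : IsOpen Ω) (hK : IsCompact K) (hKΩ : K ⊆ Ω) (hp : 1 < p)
    (hp2 : p < 2) (hV : ContinuousOn V Ω) (hφ : ContDiff ℝ 1 φ) (h0 : ∀ x ∉ K, φ x = 0)
    (hu : ∀ t ∈ Icc α β, IsPosRegular Ω p (u t))
    (hv : IsSeparatelyRegular Ω α β (fun t => powerPotential p (u t))
      fun t x => scaledLap p (u t) x + V x) (N : ℝ) :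
    ∃ C, HasAnchors (volume.restrict K) α β (fun t x => |φ x| ^ p * powerPotential p (u t) x)
      (fun t x => |φ x| ^ p * (scaledLap p (u t) x + V x)) N C := by
  have hP := contDiff_abs_rpow hp hφ
  have h0' := abs_rpow_eq_zero_of_notMem hp h0
  set D := ∫ x, ‖gradient φ x‖ ^ p
  refine ⟨2 * D + 4 * (N * volume.real K + |∫ x, |φ x| ^ p * V x| + (2 ^ (p - 1)) ^ p * D) +
    N * volume.real K, fun a ha hN δ hδ => ?_⟩
  set C := 2 * D + 4 * (N * volume.real K + |∫ x, |φ x| ^ p * V x| + (2 ^ (p - 1)) ^ p * D) +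
    N * volume.real K
  have hva := hv.pos a ha
  have hua := hu a ha
  set b := powerPotential p (u a) with hb
  set A := ∫ x, |φ x| ^ p * b x with hA
  have hA0 : 0 ≤ A := integral_nonneg fun x => by
    by_cases hx : x ∈ K
    · have := hva x (hKΩ hx)
      positivity
    · simp [h0' x hx]
  have hl2 : 0 < Real.log 2 := Real.log_pos one_lt_two
  obtain ⟨d, hd, hdA⟩ : ∃ d > 0, d * (Real.log 2 * A) ≤ δ := by
    refine ⟨δ / (1 + Real.log 2 * A), by positivity, ?_⟩
    rw [div_mul_eq_mul_div, div_le_iff₀ (by positivity)]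
    nlinarith
  have hbc : ContinuousOn b Ω := hua.contDiffOn_powerPotential.continuousOn
  have hspc : Continuous (softplus d) := continuous_iff_continuousAt.2 fun r =>
    (hasDerivAt_softplus hd r).continuousAt
  obtain ⟨M, hM⟩ := ((hP.continuous.continuousOn.mul hbc).continuous_of_eq_zero hΩ hK.isClosed hKΩ
    fun x hx => by simp [h0' x hx]).bounded_above_of_compact_support
    (.intro hK fun x hx => by simp [h0' x hx])
  have hM0 : 0 ≤ M := (norm_nonneg _).trans (hM 0)
  have hratio : ∀ t ∈ Icc α β,
      ContinuousOn (fun x => 1 - powerPotential p (u t) x / b x) Ω := fun t ht =>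
    continuousOn_const.sub ((hv.continuousOn t ht).div hbc fun x hx => (hva x hx).ne')
  have hζ : ∀ t ∈ Icc α β, ContDiffOn ℝ 1
      (fun x => Real.sigmoid ((1 - powerPotential p (u t) x / b x) / d)) Ω := fun t ht =>
    contDiffOn_sigmoid_ratio (hu t ht) hua hp2 d
  have hflow := hv.isLowerFlow_comp (μ := volume) hΩ hK hKΩ hP.continuous
    (fun x => by positivity) h0'
    (Ψ := fun x r => -(b x * softplus d (1 - r / b x)))
    (ψ := fun x r => Real.sigmoid ((1 - r / b x) / d))
    (fun x hx r _ => hasDerivAt_neg_mul_softplus hd (hva x hx).ne' r)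
    (fun x _ r _ => Real.sigmoid_nonneg _) (fun x _ r _ => Real.sigmoid_le_one _)
    (fun x _ => (continuous_sigmoid.comp (by fun_prop)).continuousOn)
    (fun t ht => (hbc.mul (hspc.comp_continuousOn (hratio t ht))).neg)
    (fun t ht => (hζ t ht).continuousOn) (M := M * softplus d 1)
    (mul_nonneg hM0 ((le_max_right _ _).trans (max_le_softplus hd 1)))
    (fun x hx r hr => ?_) (c := fun _ => -C) (by simp) fun t ht => ?_
  · refine ⟨_, _, _, hflow, fun t _ => le_rfl, fun t ht x => ?_, ?_⟩
    · by_cases hx : x ∈ K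
      · have hb0 : 0 < b x := hva x (hKΩ hx)
        have h := mul_le_mul_of_nonneg_left (max_le_softplus hd
          (1 - powerPotential p (u t) x / b x)) (by positivity : 0 ≤ |φ x| ^ p * b x)
        rw [mul_max_of_nonneg _ _ (by positivity), mul_zero] at h
        refine le_trans (le_of_eq ?_) (h.trans (le_of_eq (by ring)))
        congr 1
        field_simp
        rfl
      · simp [h0' x hx]
    · rw [setIntegral_eq_integral_of_forall_compl_eq_zero fun x hx => by simp [h0' x hx]]
      refine le_trans (le_of_eq ?_) hdA
      rw [hA, ← integral_const_mul, ← integral_const_mul]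
      congr 1
      ext x
      by_cases hx : x ∈ K
      · have hb0 : b x ≠ 0 := (hva x (hKΩ hx)).ne'
        simp only [← hb, div_self hb0, sub_self, softplus_zero]
        ring
      · simp [h0' x hx]
  · have hb0 : 0 < b x := hva x hx
    have hr' : 0 < r := hr
    rw [mul_neg, abs_neg, ← mul_assoc, abs_mul, abs_of_nonneg ((le_max_right _ _).trans
      (max_le_softplus hd _))]
    exact mul_le_mul (hM x) (softplus_mono hd (by
      have := div_pos hr' hb0
      linarith)) ((le_max_right _ _).trans (max_le_softplus hd _)) hM0
  · have hlow := (hu t ht).neg_le_integral_sub hua hΩ hK hKΩ hp (hζ t ht) hφ h0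
      (fun x _ => Real.sigmoid_nonneg _) (fun x _ => Real.sigmoid_le_one _)
      fun x hx => exists_fderiv_sigmoid_ratio (hu t ht) hua hΩ hp2 hd hx
    set ζ := fun x => Real.sigmoid ((1 - powerPotential p (u t) x / b x) / d) with hζ_def
    have hζc : ContinuousOn ζ Ω := (hζ t ht).continuousOn
    have hi1 : Integrable fun x => |φ x| ^ p * (ζ x * scaledLap p (u t) x) :=
      integrable_abs_rpow_mul hΩ hK hKΩ hp hφ h0
        (hζc.mul ((hu t ht).continuousOn_scaledLap hΩ))
    have hi2 : Integrable fun x => |φ x| ^ p * (ζ x * scaledLap p (u a) x) :=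
      integrable_abs_rpow_mul hΩ hK hKΩ hp hφ h0 (hζc.mul (hua.continuousOn_scaledLap hΩ))
    have hi3 : Integrable fun x => |φ x| ^ p * (ζ x * V x) :=
      integrable_abs_rpow_mul hΩ hK hKΩ hp hφ h0 (hζc.mul hV)
    have hi4 := integrable_abs_rpow_mul hΩ hK hKΩ hp hφ h0 (hua.continuousOn_scaledLap hΩ)
    have hi5 := integrable_abs_rpow_mul hΩ hK hKΩ hp hφ h0 hV
    have e1 : ∫ x, |φ x| ^ p * (ζ x * (scaledLap p (u t) x + V x)) =
        (∫ x, |φ x| ^ p * (ζ x * scaledLap p (u t) x)) + ∫ x, |φ x| ^ p * (ζ x * V x) := by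
      rw [← integral_add hi1 hi3]
      congr 1; ext x; ring
    have e2 : ∫ x, |φ x| ^ p * (ζ x * (scaledLap p (u a) x + V x)) =
        (∫ x, |φ x| ^ p * (ζ x * scaledLap p (u a) x)) + ∫ x, |φ x| ^ p * (ζ x * V x) := by
      rw [← integral_add hi2 hi3]
      congr 1; ext x; ring
    have e3 : ∫ x, |φ x| ^ p * (scaledLap p (u a) x + V x) =
        (∫ x, |φ x| ^ p * scaledLap p (u a) x) + ∫ x, |φ x| ^ p * V x := by
      rw [← integral_add hi4 hi5]
      congr 1; ext x; ring
    have b3 := abs_integral_le_of_abs_le hK (fun x hx => by simp [h0' x hx]) hN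
    have b2 : |∫ x, |φ x| ^ p * (ζ x * (scaledLap p (u a) x + V x))| ≤ N * volume.real K :=
      abs_integral_le_of_abs_le hK (fun x hx => by simp [h0' x hx]) fun x => by
        refine le_trans ?_ (hN x)
        rw [mul_left_comm, abs_mul, abs_of_nonneg (Real.sigmoid_nonneg _)]
        exact mul_le_of_le_one_left (abs_nonneg _) (Real.sigmoid_le_one _)
    have b4 := neg_abs_le (∫ x, |φ x| ^ p * V x)
    have b3' := (abs_le.1 b3).2
    have b2' := (abs_le.1 b2).1
    linarith

end Anchors

section Conclusion

variable {n : ℕ} {Ω K : Set (EuclideanSpace ℝ (Fin n))} {p α β : ℝ}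
  {V φ : EuclideanSpace ℝ (Fin n) → ℝ} {u : ℝ → EuclideanSpace ℝ (Fin n) → ℝ}

theorem flowMono_powerPotential (hΩ : IsOpen Ω) (hK : IsCompact K) (hKΩ : K ⊆ Ω) (hp : 1 < p)
    (hp2 : p < 2) (hV : ContinuousOn V Ω) (hφ : ContDiff ℝ 1 φ) (h0 : ∀ x ∉ K, φ x = 0)
    (hu : ∀ t ∈ Icc α β, IsPosRegular Ω p (u t))
    (hv : IsSeparatelyRegular Ω α β (fun t => powerPotential p (u t))
      fun t x => scaledLap p (u t) x + V x) (hαβ : α ≤ β) :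
    FlowMono (volume.restrict K) α β (fun t x => |φ x| ^ p * powerPotential p (u t) x)
      (fun t x => |φ x| ^ p * (scaledLap p (u t) x + V x)) α β := by
  have hP := contDiff_abs_rpow hp hφ
  have h0' := abs_rpow_eq_zero_of_notMem hp h0
  have : IsFiniteMeasure (volume.restrict K) := isFiniteMeasure_restrict.2 hK.measure_ne_top
  refine flowMono_of_hasAnchors hαβ (fun x => ?_) (fun t ht => ?_)
    (exists_hasAnchors hΩ hK hKΩ hp hp2 hV hφ h0 hu hv)
  · by_cases hx : x ∈ K
    · exact continuousOn_const.mul (hv.continuousOn_time x (hKΩ hx))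
    · simpa [h0' x hx] using continuousOn_const
  · exact ((hP.continuous.continuousOn.mul (hv.continuousOn_deriv t ht)).continuous_of_eq_zero hΩ
      hK.isClosed hKΩ fun x hx => by simp [h0' x hx]).bounded_above_of_compact_support
      (.intro hK fun x hx => by simp [h0' x hx])

theorem tendsto_dampedEnergy (hΩ : IsOpen Ω) (hK : IsCompact K) (hKΩ : K ⊆ Ω) (hp : 1 < p)
    (hp2 : p < 2) (hV : ContinuousOn V Ω) (hφ : ContDiff ℝ 1 φ) (h0 : ∀ x ∉ K, φ x = 0)
    {t : ℝ} (hu : IsPosRegular Ω p (u t)) :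
    (∀ ε > 0, ‖dampedEnergy p V φ u ε t‖ ≤ ∫ x, ‖|φ x| ^ p * V x - ‖gradient φ x‖ ^ p‖) ∧
    Tendsto (fun k : ℕ => dampedEnergy p V φ u (1 / ((k : ℝ) + 1)) t) atTop
      (𝓝 (∫ x, (|φ x| ^ p * V x - ‖gradient φ x‖ ^ p))) := by
  have hP := contDiff_abs_rpow hp hφ
  have h0' := abs_rpow_eq_zero_of_notMem hp h0
  have hG := continuous_norm_gradient_rpow hp hφ
  have hG0 := norm_gradient_rpow_eq_zero_of_notMem hp hK h0
  set f := fun x => |φ x| ^ p * V x - ‖gradient φ x‖ ^ p with hf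
  have hfc : ContinuousOn f Ω := (hP.continuous.continuousOn.mul hV).sub hG.continuousOn
  have hf0 : ∀ x ∉ K, f x = 0 := fun x hx => by simp [hf, h0' x hx, hG0 x hx]
  have hfi : Integrable f := hfc.integrable_of_eq_zero hΩ hK hKΩ hf0
  have hle : ∀ ε > 0, ∀ x, ‖((1 + ε * powerPotential p (u t) x) ^ 2)⁻¹ * f x‖ ≤ ‖f x‖ := by
    intro ε hε x
    by_cases hx : x ∈ K
    · have := mul_pos hε (hu.powerPotential_pos hp2 x (hKΩ hx))
      rw [norm_mul, Real.norm_of_nonneg (by positivity)]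
      exact mul_le_of_le_one_left (norm_nonneg _)
        (inv_le_one_of_one_le₀ (one_le_pow₀ (by linarith)))
    · simp [hf0 x hx]
  refine ⟨fun ε hε => norm_integral_le_of_norm_le hfi.norm (ae_of_all _ (hle ε hε)), ?_⟩
  refine tendsto_integral_of_dominated_convergence (fun x => ‖f x‖) (fun k => ?_) hfi.norm
    (fun k => ae_of_all _ (hle _ Nat.one_div_pos_of_nat)) (ae_of_all _ fun x => ?_)
  · refine (ContinuousOn.continuous_of_eq_zero ((ContinuousOn.inv₀ ((continuousOn_const.add
      (continuousOn_const.mul hu.contDiffOn_powerPotential.continuousOn)).pow 2)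
      fun x hx => ?_).mul hfc) hΩ hK.isClosed hKΩ fun x hx => ?_).aestronglyMeasurable
    · have := mul_pos (Nat.one_div_pos_of_nat (α := ℝ) (n := k)) (hu.powerPotential_pos hp2 x hx)
      exact pow_ne_zero 2
        (by linarith : 0 < 1 + 1 / ((k : ℝ) + 1) * powerPotential p (u t) x).ne'
    · simp [hf0 x hx]
  · have h : Tendsto (fun k : ℕ => ((1 + 1 / ((k : ℝ) + 1) * powerPotential p (u t) x) ^ 2)⁻¹ *
        f x) atTop (𝓝 (((1 + 0 * powerPotential p (u t) x) ^ 2)⁻¹ * f x)) :=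
      (((((tendsto_one_div_add_atTop_nhds_zero_nat).mul_const _).const_add 1).pow 2).inv₀
        (by simp)).mul_const _
    simpa using h

theorem tendsto_integral_damped (hΩ : IsOpen Ω) (hK : IsCompact K) (hKΩ : K ⊆ Ω) (hp : 1 < p)
    (hp2 : p < 2) (hφ : ContDiff ℝ 1 φ) (h0 : ∀ x ∉ K, φ x = 0)
    {t : ℝ} (hu : IsPosRegular Ω p (u t)) :
    Tendsto (fun k : ℕ => ∫ x in K, |φ x| ^ p * (powerPotential p (u t) x /
      (1 + 1 / ((k : ℝ) + 1) * powerPotential p (u t) x))) atTop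
      (𝓝 (∫ x in K, |φ x| ^ p * powerPotential p (u t) x)) := by
  have hP := contDiff_abs_rpow hp hφ
  have h0' := abs_rpow_eq_zero_of_notMem hp h0
  have hvc := hu.contDiffOn_powerPotential.continuousOn
  refine tendsto_integral_of_dominated_convergence
    (fun x => |φ x| ^ p * powerPotential p (u t) x) (fun k => ?_)
    (integrable_abs_rpow_mul hΩ hK hKΩ hp hφ h0 hvc).restrict (fun k => ae_of_all _ fun x => ?_)
    (ae_of_all _ fun x => ?_)
  · refine (integrable_abs_rpow_mul hΩ hK hKΩ hp hφ h0 (hvc.div (continuousOn_const.add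
      (continuousOn_const.mul hvc)) fun x hx => ?_)).restrict.aestronglyMeasurable
    have := mul_pos (Nat.one_div_pos_of_nat (α := ℝ) (n := k)) (hu.powerPotential_pos hp2 x hx)
    exact (by linarith : 0 < 1 + 1 / ((k : ℝ) + 1) * powerPotential p (u t) x).ne'
  · by_cases hx : x ∈ K
    · have hr := hu.powerPotential_pos hp2 x (hKΩ hx)
      have := mul_pos (Nat.one_div_pos_of_nat (α := ℝ) (n := k)) hr
      rw [Real.norm_of_nonneg (by positivity)]
      exact mul_le_mul_of_nonneg_left (div_le_self hr.le (by linarith)) (by positivity)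
    · simp [h0' x hx]
  · have h : Tendsto (fun k : ℕ => |φ x| ^ p * (powerPotential p (u t) x /
        (1 + 1 / ((k : ℝ) + 1) * powerPotential p (u t) x))) atTop
        (𝓝 (|φ x| ^ p * (powerPotential p (u t) x / (1 + 0 * powerPotential p (u t) x)))) :=
      (tendsto_const_nhds.div (((tendsto_one_div_add_atTop_nhds_zero_nat).mul_const _).const_add 1)
        (by simp)).const_mul _
    simpa using h

theorem mul_integral_le_integral_powerPotential_sub (hΩ : IsOpen Ω) (hK : IsCompact K)
    (hKΩ : K ⊆ Ω) (hp : 1 < p) (hp2 : p < 2) (hV : ContinuousOn V Ω) (hφ : ContDiff ℝ 1 φ)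
    (h0 : ∀ x ∉ K, φ x = 0) (hu : ∀ t ∈ Icc α β, IsPosRegular Ω p (u t))
    (hv : IsSeparatelyRegular Ω α β (fun t => powerPotential p (u t))
      fun t x => scaledLap p (u t) x + V x) (hαβ : α ≤ β) :
    (β - α) * ∫ x, (|φ x| ^ p * V x - ‖gradient φ x‖ ^ p) ≤
      (∫ x in K, |φ x| ^ p * powerPotential p (u β) x) -
        ∫ x in K, |φ x| ^ p * powerPotential p (u α) x := by
  have hflow : ∀ k : ℕ, _ := fun k => isLowerFlow_damped hΩ hK hKΩ hp hp2 hV hφ h0 hu hv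
    (Nat.one_div_pos_of_nat (α := ℝ) (n := k))
  have hmono := flowMono_powerPotential hΩ hK hKΩ hp hp2 hV hφ h0 hu hv hαβ
  have hsub : uIoc α β ⊆ Icc α β := uIoc_of_le hαβ ▸ Ioc_subset_Icc_self
  have hlim := intervalIntegral.tendsto_integral_filter_of_dominated_convergence
    (μ := volume) (a := α) (b := β) (l := atTop)
    (F := fun (k : ℕ) t => dampedEnergy p V φ u (1 / ((k : ℝ) + 1)) t)
    (f := fun _ => ∫ x, (|φ x| ^ p * V x - ‖gradient φ x‖ ^ p))
    (fun _ => ∫ x, ‖|φ x| ^ p * V x - ‖gradient φ x‖ ^ p‖)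
    (.of_forall fun k => (hflow k).rate.aestronglyMeasurable.mono_set hsub)
    (.of_forall fun k => ae_of_all _ fun t ht =>
      (tendsto_dampedEnergy hΩ hK hKΩ hp hp2 hV hφ h0 (hu t (hsub ht))).1 _
        Nat.one_div_pos_of_nat)
    intervalIntegrable_const
    (ae_of_all _ fun t ht =>
      (tendsto_dampedEnergy hΩ hK hKΩ hp hp2 hV hφ h0 (hu t (hsub ht))).2)
  rw [intervalIntegral.integral_const, smul_eq_mul] at hlim
  exact le_of_tendsto_of_tendsto' hlim
    ((tendsto_integral_damped hΩ hK hKΩ hp hp2 hφ h0 (hu β ⟨hαβ, le_rfl⟩)).sub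
      (tendsto_integral_damped hΩ hK hKΩ hp hp2 hφ h0 (hu α ⟨le_rfl, hαβ⟩)))
    fun k => hmono _ _ _ (hflow k)

theorem isSeparatelyRegular_of_pde {T : ℝ} (hΩ : IsOpen Ω) (hp2 : p < 2)
    (hV : ContinuousOn V Ω) (hu : ∀ t ∈ Ioo 0 T, IsPosRegular Ω p (u t))
    (hreg_t : ∀ x ∈ Ω, ContDiffOn ℝ 1 (fun t => u t x) (Ioo 0 T))
    (hPDE : ∀ t ∈ Ioo 0 T, ∀ x ∈ Ω,
      deriv (fun s => u s x) t = pLaplacian p (u t) x + V x * u t x ^ (p - 1))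
    (hsub : Icc α β ⊆ Ioo 0 T) :
    IsSeparatelyRegular Ω α β (fun t => powerPotential p (u t))
      fun t x => scaledLap p (u t) x + V x := by
  have hg : ∀ t ∈ Ioo 0 T, ∀ x ∈ Ω,
      u t x ^ (1 - p) * deriv (fun s => u s x) t = scaledLap p (u t) x + V x := by
    intro t ht x hx
    have h0 := (hu t ht).pos x hx
    rw [hPDE t ht x hx, scaledLap, mul_add, mul_left_comm, ← Real.rpow_add h0]
    simp
  refine ⟨fun t ht => (hu t (hsub ht)).powerPotential_pos hp2, fun t ht x hx => ?_,
    fun x hx => ?_, fun t ht => (hu t (hsub ht)).contDiffOn_powerPotential.continuousOn,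
    fun t ht => ((hu t (hsub ht)).continuousOn_scaledLap hΩ).add hV⟩
  · have h0 := (hu t (hsub ht)).pos x hx
    have h1 := (((hreg_t x hx).differentiableOn one_ne_zero).differentiableAt
      (isOpen_Ioo.mem_nhds (hsub ht))).hasDerivAt
    refine ((h1.rpow_const (p := 2 - p) (.inl h0.ne')).div_const (2 - p)).congr_deriv ?_
    rw [← hg t (hsub ht) x hx, show 2 - p - 1 = 1 - p by ring]
    have : 2 - p ≠ 0 := by linarith
    field_simp
  · refine ContinuousOn.congr (f := fun t => u t x ^ (1 - p) * deriv (fun s => u s x) t) ?_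
      fun t ht => (hg t (hsub ht) x hx).symm
    exact (((hreg_t x hx).continuousOn.mono hsub).rpow_const
      fun t ht => .inl ((hu t (hsub ht)).pos x hx).ne').mul
      (((hreg_t x hx).continuousOn_deriv_of_isOpen isOpen_Ioo le_rfl).mono hsub)

end Conclusion

/-- **Key inequality (4.8)** in the proof of Theorem 4.1 (Euclidean,
classical-solution version): if `u > 0` solves `u_t = Δ_p u + V u^{p−1}`
classically on `Ω × (0,T)` with `1 < p < 2`, then for every smooth `φ`
compactly supported in `Ω` and all `0 < t₁ < t₂ < T`,
`∫_Ω V|φ|^p − ∫_Ω ‖∇φ‖^p ≤ (1/((2−p)(t₂−t₁))) ∫_Ω (u(·,t₂)^{2−p} − u(·,t₁)^{2−p}) |φ|^p`. -/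
theorem parabolic_key_inequality {n : ℕ} (Ω : Set (EuclideanSpace ℝ (Fin n)))
    (hΩo : IsOpen Ω) (hΩb : Bornology.IsBounded Ω)
    (p T : ℝ) (hp1 : 1 < p) (hp2 : p < 2) (hT : 0 < T)
    (V : EuclideanSpace ℝ (Fin n) → ℝ) (hV : ContinuousOn V Ω)
    (u : ℝ → EuclideanSpace ℝ (Fin n) → ℝ)
    (hpos : ∀ t ∈ Ioo 0 T, ∀ x ∈ Ω, 0 < u t x)
    (hreg_t : ∀ x ∈ Ω, ContDiffOn ℝ 1 (fun t => u t x) (Ioo 0 T))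
    (hreg_x : ∀ t ∈ Ioo 0 T, ContDiffOn ℝ 2 (u t) Ω)
    (hreg_F : ∀ t ∈ Ioo 0 T, ContDiffOn ℝ 1 (pVF p (u t)) Ω)
    (hPDE : ∀ t ∈ Ioo 0 T, ∀ x ∈ Ω,
      deriv (fun s => u s x) t = pLaplacian p (u t) x + V x * u t x ^ (p - 1)) :
    ∀ φ : EuclideanSpace ℝ (Fin n) → ℝ, ContDiff ℝ (⊤ : ℕ∞) φ →
      HasCompactSupport φ → tsupport φ ⊆ Ω →
      ∀ t₁ t₂ : ℝ, 0 < t₁ → t₁ < t₂ → t₂ < T →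
        (∫ x in Ω, V x * |φ x| ^ p) - (∫ x in Ω, ‖gradient φ x‖ ^ p) ≤
          (1 / ((2 - p) * (t₂ - t₁))) *
            ∫ x in Ω, (u t₂ x ^ (2 - p) - u t₁ x ^ (2 - p)) * |φ x| ^ p := by

  intro φ hφ hφc hφΩ t₁ t₂ ht₁ ht₁₂ ht₂
  have hφ1 : ContDiff ℝ 1 φ := hφ.of_le (by exact_mod_cast le_top)
  have h0 : ∀ x ∉ tsupport φ, φ x = 0 := fun x hx => image_eq_zero_of_notMem_tsupport hx
  have hu : ∀ t ∈ Ioo 0 T, IsPosRegular Ω p (u t) := fun t ht =>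
    ⟨hpos t ht, hreg_x t ht, hreg_F t ht⟩
  have hsub : Icc t₁ t₂ ⊆ Ioo 0 T := fun t ht => ⟨ht₁.trans_le ht.1, ht.2.trans_lt ht₂⟩
  have h0' := abs_rpow_eq_zero_of_notMem hp1 h0
  have hG0 := norm_gradient_rpow_eq_zero_of_notMem hp1 hφc.isCompact h0
  have hmain := mul_integral_le_integral_powerPotential_sub hΩo hφc.isCompact hφΩ hp1 hp2 hV hφ1
    h0 (fun t ht => hu t (hsub ht)) (isSeparatelyRegular_of_pde hΩo hp2 hV hu hreg_t hPDE hsub)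
    ht₁₂.le
  have hi : ∀ {f : EuclideanSpace ℝ (Fin n) → ℝ}, ContinuousOn f Ω →
      Integrable fun x => |φ x| ^ p * f x :=
    integrable_abs_rpow_mul hΩo hφc.isCompact hφΩ hp1 hφ1 h0
  have hv : ∀ t ∈ Ioo 0 T, Integrable fun x => |φ x| ^ p * powerPotential p (u t) x :=
    fun t ht => hi (hu t ht).contDiffOn_powerPotential.continuousOn
  rw [setIntegral_eq_integral_of_forall_compl_eq_zero fun x hx => by simp [h0' x hx],
    setIntegral_eq_integral_of_forall_compl_eq_zero fun x hx => by simp [h0' x hx],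
    integral_sub (hi hV) ((continuous_norm_gradient_rpow hp1 hφ1).continuousOn.integrable_of_eq_zero
      hΩo hφc.isCompact hφΩ hG0),
    ← integral_sub (hv t₂ (hsub (right_mem_Icc.2 ht₁₂.le)))
      (hv t₁ (hsub (left_mem_Icc.2 ht₁₂.le)))] at hmain
  rw [setIntegral_eq_integral_of_forall_compl_eq_zero
      fun x hx => by simp [h0' x fun h => hx (hφΩ h)],
    setIntegral_eq_integral_of_forall_compl_eq_zero
      fun x hx => by simp [hG0 x fun h => hx (hφΩ h)],
    setIntegral_eq_integral_of_forall_compl_eq_zero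
      fun x hx => by simp [h0' x fun h => hx (hφΩ h)]]
  have hp : 0 < 2 - p := by linarith
  have ht : 0 < t₂ - t₁ := by linarith
  have e : ∫ x, (u t₂ x ^ (2 - p) - u t₁ x ^ (2 - p)) * |φ x| ^ p = (2 - p) *
      ∫ x, (|φ x| ^ p * powerPotential p (u t₂) x - |φ x| ^ p * powerPotential p (u t₁) x) := by
    rw [← integral_const_mul]
    congr 1
    ext x
    simp only [powerPotential]
    field_simp
  simp_rw [mul_comm (V _)]
  rw [e, one_div_mul_eq_div, mul_div_mul_left _ _ hp.ne', le_div_iff₀' ht]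
  exact hmain
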